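/- arXiv:1404.3403 — 3 statements merged into one kernel-verified Lean document; each statement's English description precedes it below -/
import Mathlib

section
/- Fix an integer d ≥ 2. For every γ > 0 there exists a constant C = C(γ, d) such that the following holds for all integers 2 ≤ m ≤ n. Let P be a set of m points sampled independently from [0,1]^d, where for each point the d coordinates are independent and the j-th coordinate is drawn from an atomless probability distribution μ_j on [0,1]. Then the probability that the number of staircase points of P exceeds C·(ln n)^{d−1} is at most m^{−γ}. -/
open MeasureTheory

/-- The staircase (set of Pareto minima) of a point set `P ⊆ ℝ^d`: points of `P`
dominated by no other point of `P`. -/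
def stair {d : ℕ} (P : Set (Fin d → ℝ)) : Set (Fin d → ℝ) :=
  {p | p ∈ P ∧ ∀ q ∈ P, q ≠ p → ¬∀ i, q i ≤ p i}

open scoped ENNReal

theorem measurable_init {E : Type*} [MeasurableSpace E] {m : ℕ} :
    Measurable fun x : Fin (m + 1) → E => Fin.init (α := fun _ => E) x :=
  measurable_pi_iff.2 fun i => measurable_pi_apply i.castSucc

theorem exists_perm_snoc_comp {E : Type*} {m : ℕ} (σ : Equiv.Perm (Fin m)) :
    ∃ τ : Equiv.Perm (Fin (m + 1)), τ (Fin.last m) = Fin.last m ∧ ∀ (z : Fin m → E) (a : E),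
      Fin.snoc (α := fun _ => E) (z ∘ σ) a = Fin.snoc (α := fun _ => E) z a ∘ τ := by
  refine ⟨(finSuccEquivLast.trans (Equiv.optionCongr σ)).trans finSuccEquivLast.symm,
    by simp, fun z a => ?_⟩
  ext i
  cases i using Fin.lastCases <;> simp

section Records

variable {E : Type*} [LE E]

open scoped Classical in
/-- The indices `k` such that no other entry of `x` is below `x k`. -/
noncomputable def undominated {m : ℕ} (x : Fin m → E) : Finset (Fin m) :=
  {k | ∀ l, l ≠ k → ¬ x l ≤ x k}

open scoped Classical in
/-- The indices `k` such that no earlier entry of `x` is below `x k`. -/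
noncomputable def records {m : ℕ} (x : Fin m → E) : Finset (Fin m) :=
  {k | ∀ l, l < k → ¬ x l ≤ x k}

open scoped Classical in
/-- The number `2 ^ #(records x)`, replaced by `0` when some prefix of `x` has more than `B`
undominated entries. -/
noncomputable def recordWeight (B : ℕ) : ∀ {m : ℕ}, (Fin m → E) → ℝ≥0∞
  | 0, _ => 1
  | m + 1, x =>
    if (undominated x).card ≤ B then
      (if Fin.last m ∈ undominated x then 2 else 1) *
        recordWeight B (Fin.init (α := fun _ => E) x)
    else 0

theorem mem_undominated {m : ℕ} {x : Fin m → E} {k : Fin m} :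
    k ∈ undominated x ↔ ∀ l, l ≠ k → ¬ x l ≤ x k := by
  simp [undominated]

theorem mem_records {m : ℕ} {x : Fin m → E} {k : Fin m} :
    k ∈ records x ↔ ∀ l, l < k → ¬ x l ≤ x k := by
  simp [records]

theorem mem_undominated_comp {m : ℕ} (x : Fin m → E) (σ : Equiv.Perm (Fin m)) (k : Fin m) :
    k ∈ undominated (x ∘ σ) ↔ σ k ∈ undominated x := by
  simp only [mem_undominated, Function.comp_apply]
  refine ⟨fun h l hl => ?_, fun h l hl => h _ (by simpa using hl)⟩
  simpa using h (σ.symm l) (by rwa [ne_eq, Equiv.symm_apply_eq])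

theorem card_undominated_comp {m : ℕ} (x : Fin m → E) (σ : Equiv.Perm (Fin m)) :
    (undominated (x ∘ σ)).card = (undominated x).card :=
  Finset.card_equiv σ fun k => mem_undominated_comp x σ k

open scoped Classical in
theorem card_records_succ {m : ℕ} (x : Fin (m + 1) → E) :
    (records x).card = (records (Fin.init (α := fun _ => E) x)).card +
      if Fin.last m ∈ undominated x then 1 else 0 := by
  have h1 : (records x).card = ∑ k, if k ∈ records x then 1 else 0 := by simp
  have h2 : (records (Fin.init (α := fun _ => E) x)).card =
      ∑ k, if k ∈ records (Fin.init (α := fun _ => E) x) then 1 else 0 := by simp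
  rw [h1, h2, Fin.sum_univ_castSucc]
  congr 1
  · refine Finset.sum_congr rfl fun k _ => if_congr ?_ rfl rfl
    simp only [mem_records, Fin.init]
    refine ⟨fun h l hl => h _ (by simpa using hl), fun h l hl => ?_⟩
    have hlt : l.val < m := lt_of_lt_of_le (Fin.lt_def.1 hl) (by simp)
    exact h ⟨l, hlt⟩ hl
  · refine if_congr ?_ rfl rfl
    simp only [mem_records, mem_undominated, Fin.lt_last_iff_ne_last]

theorem two_pow_card_records_le_recordWeight (B : ℕ) {m : ℕ} (x : Fin m → E)
    (hx : recordWeight B x ≠ 0) : 2 ^ (records x).card ≤ recordWeight B x := by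
  classical
  induction m with
  | zero => simp [recordWeight, records]
  | succ m ih =>
    rw [recordWeight] at hx ⊢
    split_ifs at hx ⊢ with h1 h2
    · rw [card_records_succ, if_pos h2, pow_succ, mul_comm]
      gcongr
      exact ih _ (right_ne_zero_of_mul hx)
    · rw [card_records_succ, if_neg h2, add_zero, one_mul]
      exact ih _ (right_ne_zero_of_mul hx)
    · exact absurd rfl hx

variable [MeasurableSpace E]

theorem measurableSet_mem_undominated (hE : MeasurableSet {p : E × E | p.1 ≤ p.2}) {m : ℕ}
    (k : Fin m) : MeasurableSet {x : Fin m → E | k ∈ undominated x} := by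
  simp only [mem_undominated, Set.ofPred_forall]
  refine MeasurableSet.iInter fun l => MeasurableSet.iInter fun _ => MeasurableSet.compl ?_
  have h : Measurable fun x : Fin m → E => (x l, x k) :=
    (measurable_pi_apply l).prodMk (measurable_pi_apply k)
  exact h hE

theorem measurableSet_mem_records (hE : MeasurableSet {p : E × E | p.1 ≤ p.2}) {m : ℕ}
    (k : Fin m) : MeasurableSet {x : Fin m → E | k ∈ records x} := by
  simp only [mem_records, Set.ofPred_forall]
  refine MeasurableSet.iInter fun l => MeasurableSet.iInter fun _ => MeasurableSet.compl ?_
  have h : Measurable fun x : Fin m → E => (x l, x k) :=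
    (measurable_pi_apply l).prodMk (measurable_pi_apply k)
  exact h hE

theorem measurable_card_of_measurableSet_mem {α ι : Type*} [MeasurableSpace α] [Fintype ι]
    {s : α → Finset ι} (hs : ∀ i, MeasurableSet {a | i ∈ s a}) :
    Measurable fun a => (s a).card := by
  classical
  have : (fun a => (s a).card) = fun a => ∑ i, if i ∈ s a then 1 else 0 := by
    ext a; simp
  rw [this]
  exact Finset.measurable_fun_sum _ fun i _ =>
    Measurable.ite (hs i) measurable_const measurable_const

theorem measurable_recordWeight (hE : MeasurableSet {p : E × E | p.1 ≤ p.2}) (B m : ℕ) :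
    Measurable fun x : Fin m → E => recordWeight B x := by
  classical
  induction m with
  | zero => exact measurable_const
  | succ m ih =>
    simp only [recordWeight]
    refine Measurable.ite ?_ (Measurable.mul (Measurable.ite
      (measurableSet_mem_undominated hE _) measurable_const measurable_const)
      (ih.comp measurable_init)) measurable_const
    exact measurable_card_of_measurableSet_mem (measurableSet_mem_undominated hE)
      measurableSet_Iic

end Records

section ProductMeasure

variable {E : Type*} [MeasurableSpace E] (ν : Measure E) [IsProbabilityMeasure ν]

theorem lintegral_pi_fin_succ {m : ℕ} {f : (Fin (m + 1) → E) → ℝ≥0∞} (hf : Measurable f) :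
    ∫⁻ x, f x ∂(Measure.pi fun _ => ν) =
      ∫⁻ a, ∫⁻ z, f (Fin.snoc (α := fun _ => E) z a) ∂(Measure.pi fun _ => ν) ∂ν := by
  have h := (measurePreserving_piFinSuccAbove (fun _ : Fin (m + 1) => ν) (Fin.last m)).symm
  have hf' := hf.comp (MeasurableEquiv.piFinSuccAbove (fun _ => E) (Fin.last m)).symm.measurable
  have h' := lintegral_prod (μ := ν) (ν := Measure.pi fun _ => ν) _ hf'.aemeasurable
  simp only [Function.comp_apply] at h'
  rw [← h.lintegral_comp_emb (MeasurableEquiv.measurableEmbedding _), h']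
  simp [MeasurableEquiv.piFinSuccAbove, Fin.insertNthEquiv]

theorem measurePreserving_init (m : ℕ) :
    MeasurePreserving (fun x : Fin (m + 1) → E => Fin.init (α := fun _ => E) x)
      (Measure.pi fun _ => ν) (Measure.pi fun _ => ν) := by
  have h := measurePreserving_piFinSuccAbove (fun _ : Fin (m + 1) => ν) (Fin.last m)
  convert measurePreserving_snd.comp h using 1
  ext x i
  simp [Fin.init]

theorem measurePreserving_comp_perm {ι : Type*} [Fintype ι] (σ : Equiv.Perm ι) :
    MeasurePreserving (fun x : ι → E => x ∘ σ) (Measure.pi fun _ => ν) (Measure.pi fun _ => ν) := by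
  convert measurePreserving_piCongrLeft (fun _ : ι => ν) σ.symm using 1
  ext x i
  obtain ⟨j, rfl⟩ := σ.symm.surjective i
  simp [MeasurableEquiv.coe_piCongrLeft, Equiv.piCongrLeft_apply_apply]

variable [LE E] {ν}

open scoped Classical in
/-- By exchangeability, the last entry of an i.i.d. sample is undominated with conditional
probability `#(undominated x) / (m + 1)` given the unordered sample. -/
theorem lintegral_undominated_last_le (hE : MeasurableSet {p : E × E | p.1 ≤ p.2}) (B : ℕ) {m : ℕ}
    {g : (Fin (m + 1) → E) → ℝ≥0∞} (hg : Measurable g)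
    (hsym : ∀ (σ : Equiv.Perm (Fin (m + 1))) x, g (x ∘ σ) = g x) :
    ∫⁻ x, (if (undominated x).card ≤ B then
        (if Fin.last m ∈ undominated x then 2 else 1) * g x else 0) ∂(Measure.pi fun _ => ν) ≤
      ENNReal.ofReal (Real.exp (B * (m + 1 : ℝ)⁻¹)) * ∫⁻ x, g x ∂(Measure.pi fun _ => ν) := by
  set u : Fin (m + 1) → (Fin (m + 1) → E) → ℝ≥0∞ := fun k x =>
    if (undominated x).card ≤ B then (if k ∈ undominated x then 2 else 1) * g x else 0 with hu
  have hmeas : ∀ k, Measurable (u k) := fun k =>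
    Measurable.ite (measurable_card_of_measurableSet_mem (measurableSet_mem_undominated hE)
      measurableSet_Iic) ((Measurable.ite (measurableSet_mem_undominated hE _) measurable_const
        measurable_const).mul hg) measurable_const
  have hswap : ∀ k, ∫⁻ x, u k x ∂(Measure.pi fun _ => ν) =
      ∫⁻ x, u (Fin.last m) x ∂(Measure.pi fun _ => ν) := fun k => by
    rw [← (measurePreserving_comp_perm ν (Equiv.swap k (Fin.last m))).lintegral_comp
      (hmeas (Fin.last m))]
    simp [hu, card_undominated_comp, mem_undominated_comp, hsym]
  have hsum : ∀ x, ∑ k, u k x ≤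
      ((m + 1 : ℕ) : ℝ≥0∞) * (ENNReal.ofReal (Real.exp (B * (m + 1 : ℝ)⁻¹)) * g x) := fun x => by
    by_cases hx : (undominated x).card ≤ B
    · have h1 : ∑ k, (if k ∈ undominated x then (2 : ℝ≥0∞) else 1) =
          ((m + 1 + (undominated x).card : ℕ) : ℝ≥0∞) := by
        have : ∀ k, (if k ∈ undominated x then (2 : ℝ≥0∞) else 1) =
            1 + if k ∈ undominated x then 1 else 0 := fun k => by
          split_ifs <;> norm_num
        simp_rw [this, Finset.sum_add_distrib]
        simp
      simp only [hu, if_pos hx]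
      rw [← Finset.sum_mul, h1, ← mul_assoc]
      gcongr
      rw [← ENNReal.ofReal_natCast, ← ENNReal.ofReal_natCast, ← ENNReal.ofReal_mul (by positivity)]
      apply ENNReal.ofReal_le_ofReal
      have h2 := Real.add_one_le_exp (B * (m + 1 : ℝ)⁻¹)
      have h3 : ((undominated x).card : ℝ) ≤ B := by exact_mod_cast hx
      have h4 : (0 : ℝ) < m + 1 := by positivity
      push_cast
      calc (m + 1 + (undominated x).card : ℝ) ≤ (m + 1) * (B * (m + 1 : ℝ)⁻¹ + 1) := by
            field_simp; linarith
        _ ≤ _ := by gcongr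
    · simp [hu, hx]
  have key : ((m + 1 : ℕ) : ℝ≥0∞) * ∫⁻ x, u (Fin.last m) x ∂(Measure.pi fun _ => ν) ≤
      ((m + 1 : ℕ) : ℝ≥0∞) * (ENNReal.ofReal (Real.exp (B * (m + 1 : ℝ)⁻¹)) *
        ∫⁻ x, g x ∂(Measure.pi fun _ => ν)) := by
    calc _ = ∑ k, ∫⁻ x, u k x ∂(Measure.pi fun _ => ν) := by simp [hswap]
      _ = ∫⁻ x, ∑ k, u k x ∂(Measure.pi fun _ => ν) :=
        (lintegral_finsetSum _ fun k _ => hmeas k).symm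
      _ ≤ _ := lintegral_mono hsum
      _ = _ := by
        rw [lintegral_const_mul _ (hg.const_mul _), lintegral_const_mul _ hg]
  exact (ENNReal.mul_le_mul_iff_right (by simp) (by simp)).1 key

/-- The weight `g` makes the induction go through; only `g = 1` is needed in the end. -/
theorem lintegral_recordWeight_mul_le (hE : MeasurableSet {p : E × E | p.1 ≤ p.2}) (B : ℕ) {m : ℕ}
    {g : (Fin m → E) → ℝ≥0∞} (hg : Measurable g)
    (hsym : ∀ (σ : Equiv.Perm (Fin m)) x, g (x ∘ σ) = g x) :
    ∫⁻ x, recordWeight B x * g x ∂(Measure.pi fun _ => ν) ≤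
      ENNReal.ofReal (Real.exp (B * harmonic m)) * ∫⁻ x, g x ∂(Measure.pi fun _ => ν) := by
  classical
  induction m with
  | zero => simp [recordWeight]
  | succ m ih =>
    set h : (Fin (m + 1) → E) → ℝ≥0∞ := fun x => if (undominated x).card ≤ B then
        (if Fin.last m ∈ undominated x then 2 else 1) * g x else 0 with hh
    have hmeas : Measurable h :=
      Measurable.ite (measurable_card_of_measurableSet_mem (measurableSet_mem_undominated hE)
        measurableSet_Iic) ((Measurable.ite (measurableSet_mem_undominated hE _) measurable_const
          measurable_const).mul hg) measurable_const
    have hsnoc : ∀ a : E, Measurable fun z : Fin m → E => Fin.snoc (α := fun _ => E) z a := by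
      refine fun a => measurable_pi_iff.2 fun i => ?_
      cases i using Fin.lastCases with
      | last => simp
      | cast i => simpa using measurable_pi_apply i
    calc ∫⁻ x, recordWeight B x * g x ∂(Measure.pi fun _ => ν)
        = ∫⁻ x, recordWeight B (Fin.init (α := fun _ => E) x) * h x ∂(Measure.pi fun _ => ν) := by
          refine lintegral_congr fun x => ?_
          simp only [recordWeight, hh]
          split_ifs <;> ring
      _ = ∫⁻ a, ∫⁻ z, recordWeight B z * h (Fin.snoc (α := fun _ => E) z a)
            ∂(Measure.pi fun _ => ν) ∂ν := by
          refine (lintegral_pi_fin_succ ν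
            (((measurable_recordWeight hE B m).comp measurable_init).mul hmeas)).trans ?_
          simp
      _ ≤ ∫⁻ a, ENNReal.ofReal (Real.exp (B * harmonic m)) *
            ∫⁻ z, h (Fin.snoc (α := fun _ => E) z a) ∂(Measure.pi fun _ => ν) ∂ν := by
          refine lintegral_mono fun a => ih (hmeas.comp (hsnoc a)) fun σ z => ?_
          obtain ⟨τ, hτ, hz⟩ := exists_perm_snoc_comp (E := E) σ
          simp only [hh, hz, card_undominated_comp, mem_undominated_comp, hτ, hsym]
      _ = ENNReal.ofReal (Real.exp (B * harmonic m)) * ∫⁻ x, h x ∂(Measure.pi fun _ => ν) := by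
          rw [lintegral_const_mul' _ _ (by simp), ← lintegral_pi_fin_succ ν hmeas]
      _ ≤ ENNReal.ofReal (Real.exp (B * harmonic m)) *
            (ENNReal.ofReal (Real.exp (B * (m + 1 : ℝ)⁻¹)) *
              ∫⁻ x, g x ∂(Measure.pi fun _ => ν)) := by
          gcongr
          exact lintegral_undominated_last_le hE B hg hsym
      _ = _ := by
          rw [← mul_assoc, ← ENNReal.ofReal_mul (Real.exp_nonneg _), ← Real.exp_add, harmonic_succ]
          push_cast
          ring_nf

theorem measure_recordWeight_eq_zero_le (hE : MeasurableSet {p : E × E | p.1 ≤ p.2}) (B : ℕ)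
    {m : ℕ} {ε : ℝ≥0∞} (hε : ∀ i ≤ m, (Measure.pi fun _ : Fin i => ν)
      {x | B < (undominated x).card} ≤ ε) :
    (Measure.pi fun _ : Fin m => ν) {x | recordWeight B x = 0} ≤ m * ε := by
  induction m with
  | zero => simp [recordWeight]
  | succ m ih =>
    have hsub : {x : Fin (m + 1) → E | recordWeight B x = 0} ⊆
        {x | B < (undominated x).card} ∪
          (fun x => Fin.init (α := fun _ => E) x) ⁻¹' {z | recordWeight B z = 0} := by
      intro x hx
      by_cases h : (undominated x).card ≤ B
      · right
        simp only [Set.mem_ofPred_eq, recordWeight, if_pos h, mul_eq_zero] at hx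
        rcases hx with hx | hx
        · split_ifs at hx <;> simp at hx
        · exact hx
      · exact Or.inl (not_le.1 h)
    refine (measure_mono hsub).trans ((measure_union_le _ _).trans ?_)
    have hzero : MeasurableSet {z : Fin m → E | recordWeight B z = 0} :=
      (measurable_recordWeight hE B m) (measurableSet_singleton 0)
    rw [(measurePreserving_init ν m).measure_preimage hzero.nullMeasurableSet, add_comm]
    push_cast
    rw [add_mul, one_mul]
    exact add_le_add (ih fun i hi => hε i (hi.trans m.le_succ)) (hε _ le_rfl)

/-- A Chernoff bound for the number of records of an i.i.d. sample. -/
theorem measure_lt_card_records_le (hE : MeasurableSet {p : E × E | p.1 ≤ p.2}) (B : ℕ)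
    {m : ℕ} {ε : ℝ≥0∞} (hε : ∀ i ≤ m, (Measure.pi fun _ : Fin i => ν)
      {x | B < (undominated x).card} ≤ ε) (t : ℝ) :
    (Measure.pi fun _ : Fin m => ν) {x | t < (records x).card} ≤
      m * ε + ENNReal.ofReal (Real.exp (B * harmonic m) / 2 ^ t) := by
  have h2 : (0 : ℝ) < 2 ^ t := by positivity
  have hsub : {x : Fin m → E | t < (records x).card} ⊆
      {x | recordWeight B x = 0} ∪ {x | ENNReal.ofReal (2 ^ t) ≤ recordWeight B x} := by
    intro x hx
    refine or_iff_not_imp_left.2 fun h =>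
      le_trans ?_ (two_pow_card_records_le_recordWeight B x h)
    have h3 : (2 : ℝ≥0∞) ^ (records x).card = ENNReal.ofReal (2 ^ ((records x).card : ℝ)) := by
      rw [Real.rpow_natCast, ENNReal.ofReal_pow (by norm_num)]
      norm_num
    rw [h3]
    exact ENNReal.ofReal_le_ofReal (Real.rpow_le_rpow_of_exponent_le (by norm_num) (le_of_lt hx))
  refine (measure_mono hsub).trans ((measure_union_le _ _).trans
    (add_le_add (measure_recordWeight_eq_zero_le hE B hε) ?_))
  refine (meas_ge_le_lintegral_div (measurable_recordWeight hE B m).aemeasurable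
    (by simpa using h2) (by simp)).trans ?_
  rw [ENNReal.ofReal_div_of_pos h2]
  gcongr
  simpa using lintegral_recordWeight_mul_le (ν := ν) hE B (m := m) (g := fun _ => 1)
    measurable_const (by simp)

end ProductMeasure

section Staircase

theorem card_undominated_le_ncard_stair {d m : ℕ} (x : Fin m → Fin d → ℝ) :
    (undominated x).card ≤ (stair (Set.range x)).ncard := by
  rw [← Set.ncard_coe_finset]
  have hfin : (stair (Set.range x)).Finite := (Set.finite_range x).subset fun p hp => hp.1
  refine Set.ncard_le_ncard_of_injOn x (fun k hk => ?_) (fun k hk l hl hkl => ?_) hfin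
  · rw [Finset.mem_coe, mem_undominated] at hk
    refine ⟨⟨k, rfl⟩, ?_⟩
    rintro _ ⟨l, rfl⟩ hlk
    exact hk l fun h => hlk (congrArg x h)
  · by_contra hne
    exact mem_undominated.1 hk l (Ne.symm hne) hkl.ge

open scoped Classical in
/-- The records of `x` when its entries are ordered by `y`, ties being broken by the index. -/
noncomputable def recordsBy {E : Type*} [LE E] {m : ℕ} (y : Fin m → ℝ) (x : Fin m → E) :
    Finset (Fin m) :=
  {k | ∀ l, (y l < y k ∨ y l = y k ∧ l < k) → ¬ x l ≤ x k}

theorem mem_recordsBy {E : Type*} [LE E] {m : ℕ} {y : Fin m → ℝ} {x : Fin m → E} {k : Fin m} :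
    k ∈ recordsBy y x ↔ ∀ l, (y l < y k ∨ y l = y k ∧ l < k) → ¬ x l ≤ x k := by
  simp [recordsBy]

theorem ncard_stair_le_card_recordsBy {d m : ℕ} (q : Fin m → Fin (d + 1) → ℝ) :
    (stair (Set.range q)).ncard ≤
      (recordsBy (fun i => q i 0) (fun i j => q i (Fin.succ j))).card := by
  rw [← Set.ncard_coe_finset]
  refine le_trans (Set.ncard_le_ncard ?_ (Set.toFinite _)) (Set.ncard_image_le (f := q)
    (Finset.finite_toSet _))
  rintro _ ⟨⟨k₀, rfl⟩, hp⟩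
  obtain ⟨k, hk : q k = q k₀, hmin⟩ :=
    (wellFounded_lt (α := Fin m)).has_min {k | q k = q k₀} ⟨k₀, rfl⟩
  refine ⟨k, ?_, hk⟩
  rw [Finset.mem_coe, mem_recordsBy]
  intro l hl hle
  have hqle : ∀ i, q l i ≤ q k i := by
    intro i
    cases i using Fin.cases with
    | zero => exact hl.elim le_of_lt fun h => h.1.le
    | succ i => exact hle i
  have heq : q l = q k₀ := by
    by_contra hne
    exact hp _ ⟨l, rfl⟩ hne (hk ▸ hqle)
  rcases hl with hl | hl
  · rw [heq, ← hk] at hl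
    exact lt_irrefl _ hl
  · exact hmin l heq hl.2

theorem card_recordsBy_le_card_records_comp_sort {E : Type*} [LE E] {m : ℕ} (y : Fin m → ℝ)
    (x : Fin m → E) : (recordsBy y x).card ≤ (records (x ∘ Tuple.sort y)).card := by
  obtain ⟨hmono, hties⟩ := Tuple.eq_sort_iff.1 (rfl : Tuple.sort y = Tuple.sort y)
  refine Finset.card_le_card_of_injOn (Tuple.sort y).symm (fun k hk => ?_)
    (Equiv.injective _).injOn
  rw [Finset.mem_coe, mem_recordsBy] at hk
  rw [Finset.mem_coe, mem_records]
  intro l hl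
  have h1 := hmono hl.le
  have h2 := hties _ _ hl
  simp only [Function.comp_apply, Equiv.apply_symm_apply] at h1 h2 ⊢
  exact hk _ (h1.lt_or_eq.imp_right fun h => ⟨h, h2 h⟩)

theorem measurableSet_mem_recordsBy {E : Type*} [LE E] [MeasurableSpace E]
    (hE : MeasurableSet {p : E × E | p.1 ≤ p.2}) {m : ℕ} (k : Fin m) :
    MeasurableSet {p : (Fin m → ℝ) × (Fin m → E) | k ∈ recordsBy p.1 p.2} := by
  have hy : ∀ l : Fin m, Measurable fun p : (Fin m → ℝ) × (Fin m → E) => p.1 l :=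
    fun l => (measurable_pi_apply l).comp measurable_fst
  have hx : ∀ l : Fin m, Measurable fun p : (Fin m → ℝ) × (Fin m → E) => (p.2 l, p.2 k) :=
    fun l => ((measurable_pi_apply l).comp measurable_snd).prodMk
      ((measurable_pi_apply k).comp measurable_snd)
  simp only [mem_recordsBy, Set.ofPred_forall, imp_iff_not_or]
  refine MeasurableSet.iInter fun l => ?_
  exact ((measurableSet_lt (hy l) (hy k)).union
    ((measurableSet_eq_fun (hy l) (hy k)).inter (MeasurableSet.const _))).compl.union
      (hx l hE).compl

theorem measurePreserving_pi_pi_succ {d m : ℕ} (μ : Fin (d + 1) → Measure ℝ)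
    [∀ j, IsProbabilityMeasure (μ j)] :
    MeasurePreserving (fun q : Fin m → Fin (d + 1) → ℝ =>
        ((fun i => q i 0, fun i j => q i (Fin.succ j)) : (Fin m → ℝ) × (Fin m → Fin d → ℝ)))
      (Measure.pi fun _ => Measure.pi μ)
      ((Measure.pi fun _ => μ 0).prod
        (Measure.pi fun _ => Measure.pi fun j : Fin d => μ (Fin.succ j))) := by
  have h1 := measurePreserving_pi (fun _ : Fin m => Measure.pi μ) _
    fun _ => measurePreserving_piFinSuccAbove μ 0
  have h2 := measurePreserving_arrowProdEquivProdArrow ℝ (Fin d → ℝ) (Fin m) (fun _ => μ 0)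
    (fun _ => Measure.pi fun j : Fin d => μ (Fin.succ j))
  exact h2.comp h1

theorem measurableSet_pi_le (d : ℕ) :
    MeasurableSet {p : (Fin d → ℝ) × (Fin d → ℝ) | p.1 ≤ p.2} := by
  simp only [Pi.le_def, Set.ofPred_forall]
  exact MeasurableSet.iInter fun i => measurableSet_le
    ((measurable_pi_apply i).comp measurable_fst) ((measurable_pi_apply i).comp measurable_snd)

/-- Sorting the sample by its first coordinate turns staircase points into records of the
remaining coordinates. -/
theorem measure_lt_ncard_stair_le {d m : ℕ} (μ : Fin (d + 1) → Measure ℝ)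
    [∀ j, IsProbabilityMeasure (μ j)] (t : ℝ) :
    (Measure.pi fun _ : Fin m => Measure.pi μ) {q | t < (stair (Set.range q)).ncard} ≤
      (Measure.pi fun _ : Fin m => Measure.pi fun j : Fin d => μ (Fin.succ j))
        {x | t < (records x).card} := by
  set S : Set ((Fin m → ℝ) × (Fin m → Fin d → ℝ)) := {p | t < (recordsBy p.1 p.2).card} with hS
  have hcard : Measurable fun p : (Fin m → ℝ) × (Fin m → Fin d → ℝ) =>
      (recordsBy p.1 p.2).card :=
    measurable_card_of_measurableSet_mem (measurableSet_mem_recordsBy (measurableSet_pi_le d))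
  have hSm : MeasurableSet S := hcard (MeasurableSet.of_discrete (s := {k : ℕ | t < k}))
  have hR : MeasurableSet {x : Fin m → Fin d → ℝ | t < (records x).card} :=
    (measurable_card_of_measurableSet_mem (measurableSet_mem_records (measurableSet_pi_le d)))
      (MeasurableSet.of_discrete (s := {k : ℕ | t < k}))
  have hsub : {q : Fin m → Fin (d + 1) → ℝ | t < (stair (Set.range q)).ncard} ⊆
      (fun q => (fun i => q i 0, fun i j => q i (Fin.succ j))) ⁻¹' S := fun q hq =>
    (Set.mem_ofPred.1 hq).trans_le (Nat.cast_le.2 (ncard_stair_le_card_recordsBy q))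
  refine (measure_mono hsub).trans ?_
  rw [(measurePreserving_pi_pi_succ μ).measure_preimage hSm.nullMeasurableSet,
    Measure.prod_apply hSm]
  refine (lintegral_mono (g := fun _ => (Measure.pi fun _ : Fin m =>
    Measure.pi fun j : Fin d => μ (Fin.succ j)) {x | t < (records x).card}) fun y => ?_).trans
      (by simp)
  rw [← (measurePreserving_comp_perm (Measure.pi fun j : Fin d => μ (Fin.succ j))
    (Tuple.sort y)).measure_preimage hR.nullMeasurableSet]
  exact measure_mono fun x hx =>
    lt_of_lt_of_le (b := ((recordsBy y x).card : ℝ)) hx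
      (Nat.cast_le.2 (card_recordsBy_le_card_records_comp_sort y x))

theorem ncard_stair_le_one (P : Set (Fin 1 → ℝ)) : (stair P).ncard ≤ 1 := by
  have h : ∀ p ∈ stair P, ∀ q ∈ stair P, p 0 ≤ q 0 → p = q := fun p hp q hq hpq => by
    by_contra hne
    exact hq.2 p hp.1 hne fun i => by rwa [Subsingleton.elim i 0]
  have hsub : (stair P).Subsingleton := fun p hp q hq =>
    (le_total (p 0) (q 0)).elim (h p hp q hq) fun hqp => (h q hq p hp hqp).symm
  rcases hsub.eq_empty_or_singleton with h | ⟨p, h⟩ <;> simp [h]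

theorem staircase_tail_estimate {d n m B : ℕ} {γ C : ℝ} (hγ : 0 < γ) (hC : 0 < C) (hn : 2 ≤ n)
    (hm : m ≤ n) (hB : (B : ℝ) ≤ C * Real.log n ^ d) :
    m * (n : ℝ) ^ (-(γ + 2)) + Real.exp (B * harmonic m) /
      2 ^ ((6 * C + 2 * (γ + 1) * 2 ^ (d + 1)) * Real.log n ^ (d + 1)) ≤ (n : ℝ) ^ (-γ) := by
  have hn2 : (2 : ℝ) ≤ n := by exact_mod_cast hn
  have hn0 : (0 : ℝ) < n := by linarith
  have hmn : (m : ℝ) ≤ n := by exact_mod_cast hm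
  set L := Real.log n with hL
  have hlog2 : (1 / 2 : ℝ) ≤ Real.log 2 := by linarith [Real.log_two_gt_d9]
  have hL2 : 1 ≤ 2 * L := by
    have := Real.log_le_log (by norm_num) hn2
    linarith
  have hL0 : 0 < L := by linarith
  have hharm : (harmonic m : ℝ) ≤ 3 * L := by
    refine (harmonic_le_one_add_log m).trans ?_
    have : Real.log m ≤ L := by
      rcases Nat.eq_zero_or_pos m with rfl | h
      · simpa using hL0.le
      · exact Real.log_le_log (by exact_mod_cast h) hmn
    linarith
  have hharm0 : (0 : ℝ) ≤ harmonic m := by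
    simp only [harmonic, Rat.cast_sum]
    exact Finset.sum_nonneg fun i _ => by positivity
  have hBh : B * (harmonic m : ℝ) ≤ 3 * C * L ^ (d + 1) :=
    calc B * (harmonic m : ℝ) ≤ (C * L ^ d) * (3 * L) := by gcongr
      _ = _ := by ring
  have hLd : L ≤ 2 ^ (d + 1) * L ^ (d + 1) := by
    have h1 : 1 ≤ (2 * L) ^ d := one_le_pow₀ hL2
    calc L ≤ 2 * L * 1 := by linarith
      _ ≤ 2 * L * (2 * L) ^ d := by gcongr
      _ = _ := by ring
  have hexp : Real.exp (B * harmonic m) /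
      2 ^ ((6 * C + 2 * (γ + 1) * 2 ^ (d + 1)) * L ^ (d + 1)) ≤ (n : ℝ) ^ (-(γ + 1)) := by
    rw [Real.rpow_def_of_pos (by norm_num : (0 : ℝ) < 2), ← Real.exp_sub,
      Real.rpow_def_of_pos hn0, ← hL]
    apply Real.exp_le_exp.2
    have h1 : 1 / 2 * ((6 * C + 2 * (γ + 1) * 2 ^ (d + 1)) * L ^ (d + 1)) ≤
        Real.log 2 * ((6 * C + 2 * (γ + 1) * 2 ^ (d + 1)) * L ^ (d + 1)) := by gcongr
    have h2 : (γ + 1) * L ≤ (γ + 1) * (2 ^ (d + 1) * L ^ (d + 1)) := by gcongr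
    linarith
  have hfirst : m * (n : ℝ) ^ (-(γ + 2)) ≤ (n : ℝ) ^ (-(γ + 1)) :=
    calc m * (n : ℝ) ^ (-(γ + 2)) ≤ n ^ (1 : ℝ) * (n : ℝ) ^ (-(γ + 2)) := by
          rw [Real.rpow_one]; gcongr
      _ = _ := by rw [← Real.rpow_add hn0]; ring_nf
  calc _ ≤ (n : ℝ) ^ (-(γ + 1)) + (n : ℝ) ^ (-(γ + 1)) := add_le_add hfirst hexp
    _ = 2 * (n : ℝ) ^ (-(γ + 1)) := by ring
    _ ≤ n ^ (1 : ℝ) * (n : ℝ) ^ (-(γ + 1)) := by rw [Real.rpow_one]; gcongr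
    _ = _ := by rw [← Real.rpow_add hn0]; ring_nf

/-- The failure probability is bounded in terms of `n` rather than of the sample size `m`, so that
the bound can be applied to all prefixes of a sample at once. -/
theorem exists_measure_lt_ncard_stair_le (d : ℕ) (γ : ℝ) (hγ : 0 < γ) :
    ∃ C : ℝ, 0 < C ∧ ∀ m n : ℕ, 2 ≤ n → m ≤ n → ∀ μ : Fin (d + 1) → Measure ℝ,
      (∀ j, IsProbabilityMeasure (μ j)) →
      (Measure.pi fun _ : Fin m => Measure.pi μ)
        {q | C * Real.log n ^ d < (stair (Set.range q)).ncard} ≤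
          ENNReal.ofReal ((n : ℝ) ^ (-γ)) := by
  induction d generalizing γ with
  | zero =>
    refine ⟨1, one_pos, fun m n _ _ μ _ => ?_⟩
    have : {q : Fin m → Fin 1 → ℝ | 1 * Real.log n ^ 0 < (stair (Set.range q)).ncard} = ∅ := by
      ext q
      simpa using ncard_stair_le_one (Set.range q)
    rw [this, measure_empty]
    exact zero_le
  | succ d ih =>
    obtain ⟨C, hC, h⟩ := ih (γ + 2) (by linarith)
    refine ⟨6 * C + 2 * (γ + 1) * 2 ^ (d + 1), by positivity, fun m n hn hm μ _ => ?_⟩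
    have hnonneg : 0 ≤ C * Real.log n ^ d := by
      have := Real.log_natCast_nonneg n
      positivity
    refine (measure_lt_ncard_stair_le μ _).trans
      ((measure_lt_card_records_le (measurableSet_pi_le (d + 1)) ⌊C * Real.log n ^ d⌋₊
        (ε := ENNReal.ofReal ((n : ℝ) ^ (-(γ + 2)))) (fun i hi => ?_) _).trans ?_)
    · refine le_trans (measure_mono fun x hx => ?_)
        (h i n hn (hi.trans hm) (fun j => μ (Fin.succ j)) fun j => inferInstance)
      have hx' : C * Real.log n ^ d < (undominated x).card := (Nat.floor_lt hnonneg).1 hx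
      exact hx'.trans_le (by exact_mod_cast card_undominated_le_ncard_stair x)
    · rw [← ENNReal.ofReal_natCast, ← ENNReal.ofReal_mul (by positivity),
        ← ENNReal.ofReal_add (by positivity) (by positivity)]
      exact ENNReal.ofReal_le_ofReal
        (staircase_tail_estimate hγ hC hn hm (Nat.floor_le hnonneg))

end Staircase

/-- Fix `d ≥ 2`.  For every `γ > 0` there is a constant `C = C(γ, d)` such that
for all `2 ≤ m ≤ n` and a set `P` of `m` points sampled independently from
`[0,1]^d` with independent coordinates, the `j`-th coordinate drawn from an
atomless probability distribution `μ_j` on `[0,1]`: the probability that the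
number of staircase points of `P` exceeds `C·(ln n)^{d-1}` is at most
`m^{-γ}`. -/
theorem staircase_count_whp (d : ℕ) (hd : 2 ≤ d) (γ : ℝ) (hγ : 0 < γ) :
    ∃ C : ℝ, 0 < C ∧
      ∀ m n : ℕ, 2 ≤ m → m ≤ n →
      ∀ μ : Fin d → Measure ℝ,
        (∀ j, IsProbabilityMeasure (μ j)) →
        (∀ j, ∀ a : ℝ, μ j {a} = 0) →
        (∀ j, μ j (Set.Icc (0 : ℝ) 1) = 1) →
        Measure.pi (fun _ : Fin m => Measure.pi μ)
            {q : Fin m → Fin d → ℝ |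
              C * Real.log n ^ (d - 1) < ((stair (Set.range q)).ncard : ℝ)}
          ≤ ENNReal.ofReal ((m : ℝ) ^ (-γ)) := by
  obtain ⟨d, rfl⟩ : ∃ e, d = e + 1 := ⟨d - 1, by omega⟩
  obtain ⟨C, hC, h⟩ := exists_measure_lt_ncard_stair_le d γ hγ
  refine ⟨C, hC, fun m n hm hmn μ hμ _ _ =>
    (measure_mono fun q hq => ?_).trans (h m m hm le_rfl μ hμ)⟩
  have hlog : Real.log m ≤ Real.log n :=
    Real.log_le_log (by positivity) (by exact_mod_cast hmn)
  have h0 : 0 ≤ Real.log m := Real.log_natCast_nonneg m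
  refine lt_of_le_of_lt ?_ (show C * Real.log n ^ d < ((stair (Set.range q)).ncard : ℝ) from hq)
  gcongr
end

section
/- Fix an integer d ≥ 2. For every γ > 0 there exists a constant C = C(γ, d) such that the following holds for all n ≥ 2. Let q_1, …, q_n be points sampled independently from [0,1]^d, where for each point the d coordinates are independent and the j-th coordinate is drawn from an atomless probability distribution μ_j on [0,1]; write Q_i = {q_1, …, q_i}. Then with probability at least 1 − n^{−γ}, the union of the staircases of all prefixes satisfies |⋃_{i=1}^n St(Q_i)| ≤ C·(ln n)^d; and with probability at least 1 − n^{−γ}, the staircase of the full set satisfies |St(Q_n)| ≤ C·(ln n)^{d−1}. -/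
open MeasureTheory

namespace Staircase

open scoped Finset

variable {α : Type*}

open Classical in
/-- The number of indices whose entry is dominated (for `r`) by no other entry. -/
noncomputable def minCount (r : α → α → Prop) {n : ℕ} (q : Fin n → α) : ℕ :=
  #{k | ∀ j, j ≠ k → ¬r (q j) (q k)}

open Classical in
/-- The number of indices whose entry is dominated (for `r`) by no later entry. -/
noncomputable def recCount (r : α → α → Prop) {n : ℕ} (q : Fin n → α) : ℕ :=
  #{k | ∀ j, k < j → ¬r (q j) (q k)}

open Classical in
/-- The variant of `recCount` which counts an index only if the suffix starting there has at most
`m` minimal entries. -/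
noncomputable def truncCount (r : α → α → Prop) (m : ℝ) : (n : ℕ) → (Fin n → α) → ℕ
  | 0, _ => 0
  | n + 1, q => truncCount r m n (Fin.tail q) +
      if (∀ j, j ≠ 0 → ¬r (q j) (q 0)) ∧ (minCount r q : ℝ) ≤ m then 1 else 0

lemma minCount_comp_perm (r : α → α → Prop) {n : ℕ} (q : Fin n → α) (σ : Equiv.Perm (Fin n)) :
    minCount r (q ∘ σ) = minCount r q := by
  classical
  unfold minCount
  refine Finset.card_equiv σ fun k => ?_
  simp only [Finset.mem_filter_univ, Function.comp_apply]
  refine ⟨fun h j hj => ?_, fun h j hj => h _ (σ.injective.ne hj)⟩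
  simpa using h (σ.symm j) (by rintro rfl; simp at hj)

open Classical in
lemma recCount_succ (r : α → α → Prop) {n : ℕ} (q : Fin (n + 1) → α) :
    recCount r q = recCount r (Fin.tail q) + if ∀ j, j ≠ 0 → ¬r (q j) (q 0) then 1 else 0 := by
  unfold recCount
  rw [Fin.card_filter_univ_succ]
  have h0 : (∀ j, 0 < j → ¬r (q j) (q 0)) ↔ ∀ j, j ≠ 0 → ¬r (q j) (q 0) := by
    simp only [Fin.pos_iff_ne_zero]
  have hs : (fun k : Fin n => ∀ j, k.succ < j → ¬r (q j) (q k.succ)) =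
      fun k => ∀ j, k < j → ¬r (Fin.tail q j) (Fin.tail q k) := by
    ext k
    simp [Fin.forall_fin_succ, Fin.tail]
  simp only [h0, hs]
  split_ifs <;> simp

/-- Averaged over all orderings of a fixed tuple, the exponential moment of `truncCount` is
bounded by that of a sum of independent Bernoulli variables of means `m / k`. -/
lemma sum_perm_exp_truncCount_le (r : α → α → Prop) {m : ℝ} (hm : 0 ≤ m) (n : ℕ) (q : Fin n → α) :
    ∑ σ : Equiv.Perm (Fin n), Real.exp (truncCount r m n (q ∘ σ)) ≤
      n.factorial * ∏ k ∈ Finset.range n, (1 + 2 * m / (k + 1)) := by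
  classical
  induction n with
  | zero => simp [truncCount]
  | succ n ih =>
    set B := (n.factorial : ℝ) * ∏ k ∈ Finset.range n, (1 + 2 * m / (k + 1)) with hB
    have hB0 : 0 ≤ B := by positivity
    let c : Fin (n + 1) → Prop := fun p => (∀ j, j ≠ p → ¬r (q j) (q p)) ∧ (minCount r q : ℝ) ≤ m
    have key (p : Fin (n + 1)) (e : Equiv.Perm (Fin n)) :
        Real.exp (truncCount r m (n + 1) (q ∘ Equiv.Perm.decomposeFin.symm (p, e))) =
          Real.exp (truncCount r m n ((fun i => q (Equiv.swap 0 p i.succ)) ∘ e)) *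
            (if c p then Real.exp 1 else 1) := by
      set σ := Equiv.Perm.decomposeFin.symm (p, e) with hσ
      have h1 : Fin.tail (q ∘ σ) = (fun i => q (Equiv.swap 0 p i.succ)) ∘ e := by
        ext i
        simp [Fin.tail, hσ]
      have h2 : (∀ j, j ≠ 0 → ¬r ((q ∘ σ) j) ((q ∘ σ) 0)) ↔ ∀ j, j ≠ p → ¬r (q j) (q p) := by
        have h0 : σ 0 = p := by simp [hσ]
        simp only [Function.comp_apply, h0]
        refine ⟨fun h j hj => ?_, fun h j hj => h _ (h0 ▸ σ.injective.ne hj)⟩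
        simpa using h (σ.symm j) (by rintro h; apply hj; rw [← h0, ← h]; simp)
      rw [truncCount, h1, minCount_comp_perm]
      simp only [h2]
      push_cast
      rw [Real.exp_add]
      congr 1
      by_cases hc : c p
      · rw [if_pos hc, if_pos hc]
      · rw [if_neg hc, if_neg hc, Real.exp_zero]
    have hcount : ((#{p | c p} : ℕ) : ℝ) ≤ m := by
      by_cases h : (minCount r q : ℝ) ≤ m
      · simp only [c, h, and_true]
        exact h
      · simpa [c, h] using hm
    have hsum : ∑ p, (if c p then Real.exp 1 else 1) ≤ (n + 1 : ℝ) + 2 * m := by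
      have : ∀ p, (if c p then Real.exp 1 else 1) ≤ 1 + 2 * (if c p then (1 : ℝ) else 0) := by
        intro p
        split_ifs
        · linarith [Real.exp_one_lt_d9]
        · simp
      refine (Finset.sum_le_sum fun p _ => this p).trans ?_
      rw [Finset.sum_add_distrib, ← Finset.mul_sum, Finset.sum_boole]
      simp only [Finset.sum_const, Finset.card_univ, Fintype.card_fin, nsmul_eq_mul]
      push_cast
      linarith
    rw [← Equiv.sum_comp Equiv.Perm.decomposeFin.symm, Fintype.sum_prod_type]
    simp only [key, ← Finset.sum_mul]
    calc _ ≤ ∑ p, B * (if c p then Real.exp 1 else 1) := by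
          gcongr with p
          exact ih _
      _ ≤ B * (n + 1 + 2 * m) := by
          rw [← Finset.mul_sum]
          gcongr
      _ = _ := by
          rw [Finset.prod_range_succ, Nat.factorial_succ, hB]
          push_cast
          field_simp

lemma prod_one_add_le_exp {m L : ℝ} (hm : 0 ≤ m) (hL : 1 ≤ L) {n : ℕ} (hn : (n : ℝ) ≤ Real.exp L) :
    ∏ k ∈ Finset.range n, (1 + 2 * m / ((k : ℝ) + 1)) ≤ Real.exp (4 * m * L) := by
  have hlog : Real.log n ≤ L := by
    rcases Nat.eq_zero_or_pos n with rfl | h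
    · simp; linarith
    · exact (Real.log_le_iff_le_exp (by exact_mod_cast h)).2 hn
  have hH := harmonic_le_one_add_log n
  rw [harmonic] at hH
  push_cast at hH
  calc _ ≤ ∏ k ∈ Finset.range n, Real.exp (2 * m / ((k : ℝ) + 1)) := by
        refine Finset.prod_le_prod (fun k _ => by positivity) fun k _ => ?_
        linarith [Real.add_one_le_exp (2 * m / ((k : ℝ) + 1))]
    _ = Real.exp (2 * m * ∑ k ∈ Finset.range n, ((k : ℝ) + 1)⁻¹) := by
        rw [← Real.exp_sum, Finset.mul_sum]
        simp only [div_eq_mul_inv]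
    _ ≤ _ := by
        have := mul_le_mul_of_nonneg_left (hH.trans (by linarith : _ ≤ 2 * L)) hm
        exact Real.exp_le_exp.2 (by linarith)

/-- A permutation sorting the tuple `x` in decreasing order. -/
noncomputable def sortPerm {n : ℕ} (x : Fin n → ℝ) : Equiv.Perm (Fin n) :=
  Tuple.sort fun i => -x i

lemma apply_sortPerm_le {n : ℕ} (x : Fin n → ℝ) {j k : Fin n} (h : k ≤ j) :
    x (sortPerm x j) ≤ x (sortPerm x k) :=
  neg_le_neg_iff.1 (Tuple.monotone_sort (fun i => -x i) h)

/-- The number of records of the remaining coordinates after sorting by coordinate `0`. -/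
noncomputable def sortedRecCount {d n : ℕ} (q : Fin n → Fin (d + 1) → ℝ) : ℕ :=
  recCount (· ≤ ·) fun i => Fin.tail (q (sortPerm (fun k => q k 0) i))

lemma minCount_le_sortedRecCount {d n : ℕ} (q : Fin n → Fin (d + 1) → ℝ) :
    minCount (· ≤ ·) q ≤ sortedRecCount q := by
  classical
  set τ := sortPerm fun k => q k 0 with hτ
  rw [← minCount_comp_perm _ q τ, minCount, sortedRecCount, recCount]
  refine Finset.card_le_card fun k => ?_
  simp only [Finset.mem_filter_univ, Function.comp_apply]
  intro h j hj hle
  exact h j hj.ne' (Pi.le_def.2 (Fin.cases (apply_sortPerm_le (fun k => q k 0) hj.le) hle))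

lemma ncard_stair_range_le_sortedRecCount {d n : ℕ} (q : Fin n → Fin (d + 1) → ℝ) :
    (stair (Set.range q)).ncard ≤ sortedRecCount q := by
  classical
  set τ := sortPerm fun k => q k 0 with hτ
  have hsub : stair (Set.range q) ⊆ (fun k => q (τ k)) '' {k | ∀ j, k < j →
      ¬Fin.tail (q (τ j)) ≤ Fin.tail (q (τ k))} := by
    rintro p ⟨⟨i, rfl⟩, hp⟩
    obtain ⟨k, hk, hmax⟩ := Set.Finite.exists_maximal
      (Set.toFinite {k | q (τ k) = q i}) ⟨τ.symm i, by simp⟩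
    refine ⟨k, fun j hj hle => ?_, hk⟩
    have hne : q (τ j) ≠ q i := fun h => absurd (hmax h hj.le) (not_le.2 hj)
    refine hp _ ⟨_, rfl⟩ hne ?_
    rw [← hk]
    exact Fin.cases (apply_sortPerm_le (fun k => q k 0) hj.le) hle
  refine (Set.ncard_le_ncard hsub (Set.toFinite _)).trans
    ((Set.ncard_image_le (Set.toFinite _)).trans ?_)
  rw [Set.ncard_eq_toFinset_card', sortedRecCount, recCount, Set.toFinset_ofPred]

lemma ncard_iUnion_stair_le_recCount {d n : ℕ} (q : Fin n → Fin d → ℝ) :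
    (⋃ i : Fin n, stair (q '' Set.Iic i)).ncard ≤ recCount (· ≤ ·) (q ∘ Fin.rev) := by
  classical
  have hsub : (⋃ i : Fin n, stair (q '' Set.Iic i)) ⊆ (fun k => (q ∘ Fin.rev) k) ''
      {k | ∀ j, k < j → ¬(q ∘ Fin.rev) j ≤ (q ∘ Fin.rev) k} := by
    intro p hp
    obtain ⟨i, ⟨l, hl, rfl⟩, hp⟩ := Set.mem_iUnion.1 hp
    obtain ⟨k, hk, hmin⟩ := Set.Finite.exists_minimal
      (Set.toFinite {k | q k = q l}) ⟨l, rfl⟩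
    have hkl : k ≤ l := by
      by_contra h
      exact h (hmin (y := l) rfl (not_le.1 h).le)
    refine ⟨k.rev, fun j hj hle => ?_, by simpa using hk⟩
    have hjk : j.rev < k := by simpa using Fin.rev_lt_rev.2 hj
    have hne : q j.rev ≠ q l := fun h => absurd (hmin h hjk.le) (not_le.2 hjk)
    refine hp _ ⟨_, (hjk.le.trans hkl).trans hl, rfl⟩ hne ?_
    rw [← hk]
    simpa using fun i => hle i
  refine (Set.ncard_le_ncard hsub (Set.toFinite _)).trans
    ((Set.ncard_image_le (Set.toFinite _)).trans ?_)
  rw [Set.ncard_eq_toFinset_card', recCount, Set.toFinset_ofPred]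

lemma recCount_le_one_of_dim_zero {n : ℕ} (q : Fin n → Fin 0 → ℝ) :
    recCount (· ≤ ·) q ≤ 1 := by
  classical
  refine Finset.card_le_one.2 fun a ha b hb => ?_
  simp only [Finset.mem_filter_univ] at ha hb
  by_contra hne
  rcases lt_or_gt_of_ne hne with h | h
  · exact ha _ h fun i => i.elim0
  · exact hb _ h fun i => i.elim0

section Probability

variable [MeasurableSpace α]

lemma measurePreserving_comp_of_injective {ι κ : Type*} [Fintype ι] [Fintype κ] (ν : Measure α)
    [IsProbabilityMeasure ν] {f : ι → κ} (hf : f.Injective) :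
    MeasurePreserving (fun q : κ → α => q ∘ f) (Measure.pi fun _ => ν) (Measure.pi fun _ => ν) := by
  have hmeas : Measurable fun q : κ → α => q ∘ f := by
    refine measurable_pi_lambda _ fun i => measurable_pi_apply (f i)
  refine ⟨hmeas, (Measure.pi_eq fun s hs => ?_).symm⟩
  have hpre : (fun q : κ → α => q ∘ f) ⁻¹' Set.univ.pi s =
      Set.univ.pi (Function.extend f s fun _ => Set.univ) := by
    ext q
    simp only [Set.mem_preimage, Set.mem_univ_pi, Function.comp_apply]
    refine ⟨fun h k => ?_, fun h i => by simpa [hf.extend_apply] using h (f i)⟩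
    by_cases hk : ∃ i, f i = k
    · obtain ⟨i, rfl⟩ := hk
      simpa [hf.extend_apply] using h i
    · simp [Function.extend_apply' _ _ _ hk]
  rw [Measure.map_apply hmeas (MeasurableSet.univ_pi hs), hpre, Measure.pi_pi]
  refine (Fintype.prod_of_injective f hf _ _ (fun k hk => ?_) fun i => ?_).symm
  · rw [Function.extend_apply' _ _ _ hk, measure_univ]
  · rw [hf.extend_apply]

lemma measurableSet_apply_apply {r : α → α → Prop} (hr : MeasurableSet {p : α × α | r p.1 p.2})
    {n : ℕ} (j k : Fin n) : MeasurableSet {q : Fin n → α | r (q j) (q k)} :=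
  measurableSet_preimage (f := fun q : Fin n → α => (q j, q k))
    ((measurable_pi_apply j).prodMk (measurable_pi_apply k)) hr

lemma measurable_minCount {r : α → α → Prop} (hr : MeasurableSet {p : α × α | r p.1 p.2}) (n : ℕ) :
    Measurable fun q : Fin n → α => minCount r q := by
  classical
  simp only [minCount, Finset.card_filter]
  refine Finset.measurable_sum _ fun k _ => Measurable.ite ?_ measurable_const measurable_const
  simp only [Set.ofPred_forall]
  exact .iInter fun j => .iInter fun _ => (measurableSet_apply_apply hr j k).compl

lemma measurable_recCount {r : α → α → Prop} (hr : MeasurableSet {p : α × α | r p.1 p.2}) (n : ℕ) :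
    Measurable fun q : Fin n → α => recCount r q := by
  classical
  simp only [recCount, Finset.card_filter]
  refine Finset.measurable_sum _ fun k _ => Measurable.ite ?_ measurable_const measurable_const
  simp only [Set.ofPred_forall]
  exact .iInter fun j => .iInter fun _ => (measurableSet_apply_apply hr j k).compl

lemma measurable_truncCount {r : α → α → Prop} (hr : MeasurableSet {p : α × α | r p.1 p.2}) (m : ℝ)
    (n : ℕ) : Measurable (truncCount r m n) := by
  classical
  induction n with
  | zero => exact measurable_const
  | succ n ih =>
    have htail : Measurable fun q : Fin (n + 1) → α => Fin.tail q :=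
      measurable_pi_lambda _ fun i => measurable_pi_apply i.succ
    change Measurable fun q : Fin (n + 1) → α => truncCount r m n (Fin.tail q) +
      if (∀ j, j ≠ 0 → ¬r (q j) (q 0)) ∧ (minCount r q : ℝ) ≤ m then 1 else 0
    refine (ih.comp htail).add (Measurable.ite (.inter ?_ ?_) measurable_const measurable_const)
    · change MeasurableSet {q : Fin (n + 1) → α | ∀ j, j ≠ 0 → ¬r (q j) (q 0)}
      simp only [Set.ofPred_forall]
      exact .iInter fun j => .iInter fun _ => (measurableSet_apply_apply hr j 0).compl
    · exact measurableSet_le (f := fun q : Fin (n + 1) → α => (minCount r q : ℝ)) (g := fun _ => m)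
        (measurable_from_top.comp (measurable_minCount hr _)) measurable_const

variable (ν : Measure α) [IsProbabilityMeasure ν]

lemma measure_recCount_ne_truncCount_le (r : α → α → Prop) {m : ℝ} {ε : ENNReal} (n : ℕ)
    (h : ∀ i ≤ n, Measure.pi (fun _ : Fin i => ν) {q | m < minCount r q} ≤ ε) :
    Measure.pi (fun _ : Fin n => ν) {q | recCount r q ≠ truncCount r m n q} ≤ n * ε := by
  classical
  induction n with
  | zero => simp [recCount, truncCount]
  | succ n ih =>
    have hsub : {q : Fin (n + 1) → α | recCount r q ≠ truncCount r m (n + 1) q} ⊆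
        (fun q => q ∘ Fin.succ) ⁻¹' {q | recCount r q ≠ truncCount r m n q} ∪
          {q | m < minCount r q} := by
      intro q hq
      by_contra hcon
      simp only [Set.mem_union, Set.mem_preimage, Set.mem_ofPred_eq, not_or, not_not, not_lt] at hcon
      refine hq ?_
      rw [recCount_succ, truncCount]
      simp only [hcon.2, and_true]
      exact congrArg (· + _) hcon.1
    have hmp := measurePreserving_comp_of_injective ν (Fin.succ_injective n)
    calc _ ≤ _ := measure_mono hsub
      _ ≤ _ := measure_union_le _ _
      _ ≤ n * ε + ε := by
        refine add_le_add ?_ (h _ le_rfl)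
        refine (Measure.le_map_apply hmp.measurable.aemeasurable _).trans ?_
        rw [hmp.map_eq]
        exact ih fun i hi => h i (hi.trans n.le_succ)
      _ = _ := by push_cast; ring

lemma lintegral_exp_truncCount_le {r : α → α → Prop} (hr : MeasurableSet {p : α × α | r p.1 p.2})
    {m L : ℝ} (hm : 0 ≤ m) (hL : 1 ≤ L) {n : ℕ} (hn : (n : ℝ) ≤ Real.exp L) :
    ∫⁻ q, ENNReal.ofReal (Real.exp (truncCount r m n q)) ∂(Measure.pi fun _ : Fin n => ν) ≤
      ENNReal.ofReal (Real.exp (4 * m * L)) := by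
  classical
  set f : (Fin n → α) → ENNReal := fun q => ENNReal.ofReal (Real.exp (truncCount r m n q)) with hf
  have hfm : Measurable f :=
    ENNReal.measurable_ofReal.comp (Real.measurable_exp.comp
      (measurable_from_top.comp (measurable_truncCount hr m n)))
  have hmp (σ : Equiv.Perm (Fin n)) := measurePreserving_comp_of_injective ν σ.injective
  have hsum : (n.factorial : ENNReal) * ∫⁻ q, f q ∂(Measure.pi fun _ : Fin n => ν) ≤
      n.factorial * ENNReal.ofReal (Real.exp (4 * m * L)) := by
    calc _ = ∑ σ : Equiv.Perm (Fin n), ∫⁻ q, f (q ∘ σ) ∂(Measure.pi fun _ : Fin n => ν) := by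
          simp [(hmp _).lintegral_comp hfm, Fintype.card_perm]
      _ = ∫⁻ q, ∑ σ : Equiv.Perm (Fin n), f (q ∘ σ) ∂(Measure.pi fun _ : Fin n => ν) :=
          (lintegral_finsetSum _ fun σ _ => hfm.comp (hmp σ).measurable).symm
      _ ≤ ∫⁻ _, n.factorial * ENNReal.ofReal (Real.exp (4 * m * L))
            ∂(Measure.pi fun _ : Fin n => ν) := by
          refine lintegral_mono fun q => ?_
          simp only [hf]
          rw [← ENNReal.ofReal_sum_of_nonneg fun _ _ => (Real.exp_pos _).le,
            ← ENNReal.ofReal_natCast, ← ENNReal.ofReal_mul (by positivity)]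
          refine ENNReal.ofReal_le_ofReal ((sum_perm_exp_truncCount_le r hm n q).trans ?_)
          gcongr
          exact prod_one_add_le_exp hm hL hn
      _ = _ := by simp
  exact (ENNReal.mul_le_mul_iff_right (by simp [Nat.factorial_ne_zero]) (by simp)).1 hsum

/-- Tail bound for the number of records in terms of tail bounds for the number of minima. -/
lemma measure_lt_recCount_le {r : α → α → Prop} (hr : MeasurableSet {p : α × α | r p.1 p.2})
    {m L t : ℝ} (hm : 0 ≤ m) (hL : 1 ≤ L) {ε : ENNReal} {n : ℕ} (hn : (n : ℝ) ≤ Real.exp L)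
    (h : ∀ i ≤ n, Measure.pi (fun _ : Fin i => ν) {q | m < minCount r q} ≤ ε) :
    Measure.pi (fun _ : Fin n => ν) {q | t < recCount r q} ≤
      n * ε + ENNReal.ofReal (Real.exp (4 * m * L - t)) := by
  have hfm : Measurable fun q : Fin n → α => ENNReal.ofReal (Real.exp (truncCount r m n q)) :=
    ENNReal.measurable_ofReal.comp (Real.measurable_exp.comp
      (measurable_from_top.comp (measurable_truncCount hr m n)))
  have hsub : {q : Fin n → α | t < recCount r q} ⊆
      {q | recCount r q ≠ truncCount r m n q} ∪
        {q | ENNReal.ofReal (Real.exp t) ≤ ENNReal.ofReal (Real.exp (truncCount r m n q))} := by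
    intro q hq
    by_cases he : recCount r q = truncCount r m n q
    · refine Or.inr (ENNReal.ofReal_le_ofReal (Real.exp_le_exp.2 ?_))
      exact he ▸ (show t < recCount r q from hq).le
    · exact Or.inl he
  refine (measure_mono hsub).trans ((measure_union_le _ _).trans
    (add_le_add (measure_recCount_ne_truncCount_le ν r n h) ?_))
  refine (meas_ge_le_lintegral_div hfm.aemeasurable (by simp [Real.exp_pos]) (by simp)).trans ?_
  rw [Real.exp_sub, ENNReal.ofReal_div_of_pos (Real.exp_pos t)]
  gcongr
  exact lintegral_exp_truncCount_le ν hr hm hL hn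

end Probability

lemma measurableSet_sortPerm_eq {n : ℕ} (σ : Equiv.Perm (Fin n)) :
    MeasurableSet {x : Fin n → ℝ | sortPerm x = σ} := by
  have : {x : Fin n → ℝ | sortPerm x = σ} =
      {x | (∀ i j, i ≤ j → -x (σ i) ≤ -x (σ j)) ∧
        ∀ i j, i < j → -x (σ i) = -x (σ j) → σ i < σ j} := by
    ext x
    rw [Set.mem_ofPred_eq, eq_comm, sortPerm, Tuple.eq_sort_iff]
    rfl
  rw [this]
  refine .inter ?_ ?_
  · change MeasurableSet {x : Fin n → ℝ | ∀ i j, i ≤ j → -x (σ i) ≤ -x (σ j)}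
    simp only [Set.ofPred_forall]
    exact .iInter fun i => .iInter fun j => .iInter fun _ =>
      measurableSet_le (measurable_pi_apply _).neg (measurable_pi_apply _).neg
  · change MeasurableSet {x : Fin n → ℝ | ∀ i j, i < j → -x (σ i) = -x (σ j) → σ i < σ j}
    simp only [Set.ofPred_forall]
    refine .iInter fun i => .iInter fun j => .iInter fun _ => ?_
    by_cases h : σ i < σ j
    · simp [h]
    · simp only [h, imp_false, neg_inj]
      exact (measurableSet_eq_fun (f := fun x : Fin n → ℝ => x (σ i))
        (g := fun x => x (σ j)) (measurable_pi_apply _) (measurable_pi_apply _)).compl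

lemma measure_lt_sortedRecCount_le {d n : ℕ} (μ : Fin (d + 1) → Measure ℝ)
    [∀ j, IsProbabilityMeasure (μ j)] (t : ℝ) :
    Measure.pi (fun _ : Fin n => Measure.pi μ) {q | t < sortedRecCount q} ≤
      Measure.pi (fun _ : Fin n => Measure.pi fun j => μ (Fin.succ j))
        {q | t < recCount (· ≤ ·) q} := by
  set P := Measure.pi (fun _ : Fin n => Measure.pi fun j => μ (Fin.succ j)) with hP
  have hmp := (measurePreserving_arrowProdEquivProdArrow ℝ (Fin d → ℝ) (Fin n) (fun _ => μ 0)
    (fun _ => Measure.pi fun j => μ (Fin.succ j))).comp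
    (measurePreserving_pi (fun _ : Fin n => Measure.pi μ) _
      fun _ => measurePreserving_piFinSuccAbove μ 0)
  have hrec : MeasurableSet {q : Fin n → Fin d → ℝ | t < recCount (· ≤ ·) q} :=
    measurableSet_lt measurable_const
      (measurable_from_top.comp (measurable_recCount measurableSet_le' n))
  have hcomp (σ : Equiv.Perm (Fin n)) := measurePreserving_comp_of_injective
    (Measure.pi fun j => μ (Fin.succ j)) σ.injective
  let E : Set ((Fin n → ℝ) × (Fin n → Fin d → ℝ)) :=
    {p | t < recCount (· ≤ ·) (p.2 ∘ sortPerm p.1)}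
  have hE : MeasurableSet E := by
    have : E = ⋃ σ : Equiv.Perm (Fin n), {x : Fin n → ℝ | sortPerm x = σ} ×ˢ
        ((fun q => q ∘ σ) ⁻¹' {q : Fin n → Fin d → ℝ | t < recCount (· ≤ ·) q}) := by
      ext ⟨x, b⟩
      simp [E]
    rw [this]
    exact .iUnion fun σ => (measurableSet_sortPerm_eq σ).prod ((hcomp σ).measurable hrec)
  calc _ = _ := hmp.measure_preimage hE.nullMeasurableSet
    _ = ∫⁻ x, P {b | t < recCount (· ≤ ·) (b ∘ sortPerm x)} ∂(Measure.pi fun _ => μ 0) :=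
        Measure.prod_apply hE
    _ = ∫⁻ _, P {q | t < recCount (· ≤ ·) q} ∂(Measure.pi fun _ => μ 0) :=
        lintegral_congr fun x => (hcomp _).measure_preimage hrec.nullMeasurableSet
    _ ≤ _ := by simp

/-- High-probability bound for the number of records of independent points in `ℝ^d`. -/
lemma exists_measure_lt_recCount_le (d : ℕ) (γ : ℝ) :
    ∃ C : ℝ, 0 < C ∧ ∀ L : ℝ, 1 ≤ L → ∀ n : ℕ, (n : ℝ) ≤ Real.exp L →
      ∀ μ : Fin d → Measure ℝ, (∀ j, IsProbabilityMeasure (μ j)) →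
        Measure.pi (fun _ : Fin n => Measure.pi μ) {q | C * L ^ d < recCount (· ≤ ·) q} ≤
          ENNReal.ofReal (Real.exp (-(γ * L))) := by
  induction d generalizing γ with
  | zero =>
    refine ⟨1, one_pos, fun L _ n _ μ _ => ?_⟩
    have : {q : Fin n → Fin 0 → ℝ | 1 * L ^ 0 < (recCount (· ≤ ·) q : ℝ)} = ∅ := by
      ext q
      simpa using recCount_le_one_of_dim_zero q
    rw [this, measure_empty]
    exact zero_le
  | succ d ih =>
    obtain ⟨C, hC, h⟩ := ih (γ + 2)
    refine ⟨4 * C + |γ| + 1, by positivity, fun L hL n hn μ hμ => ?_⟩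
    have hL0 : 0 ≤ L := by linarith
    have hmin (i : ℕ) (hi : i ≤ n) : Measure.pi (fun _ : Fin i => Measure.pi μ)
        {q | C * L ^ d < minCount (· ≤ ·) q} ≤ ENNReal.ofReal (Real.exp (-((γ + 2) * L))) := by
      refine (measure_mono fun q hq => ?_).trans ((measure_lt_sortedRecCount_le μ _).trans
        (h L hL i ((Nat.cast_le.2 hi).trans hn) _ fun j => hμ j.succ))
      exact lt_of_lt_of_le (Set.mem_ofPred_eq ▸ hq) (Nat.cast_le.2 (minCount_le_sortedRecCount q))
    refine (measure_lt_recCount_le (Measure.pi μ) measurableSet_le' (by positivity) hL hn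
      hmin).trans ?_
    rw [← ENNReal.ofReal_natCast, ← ENNReal.ofReal_mul (by positivity),
      ← ENNReal.ofReal_add (by positivity) (by positivity)]
    refine ENNReal.ofReal_le_ofReal ?_
    have h1 : (n : ℝ) * Real.exp (-((γ + 2) * L)) ≤ Real.exp (-(γ * L)) * Real.exp (-L) := by
      calc _ ≤ Real.exp L * Real.exp (-((γ + 2) * L)) := by gcongr
        _ = _ := by rw [← Real.exp_add, ← Real.exp_add]; ring_nf
    have h2 : Real.exp (4 * (C * L ^ d) * L - (4 * C + |γ| + 1) * L ^ (d + 1)) ≤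
        Real.exp (-(γ * L)) * Real.exp (-L) := by
      rw [← Real.exp_add]
      refine Real.exp_le_exp.2 ?_
      have hp : (|γ| + 1) * L ≤ (|γ| + 1) * L ^ (d + 1) := by
        gcongr
        exact le_self_pow₀ hL (by omega)
      have hq : γ * L ≤ |γ| * L := by
        gcongr
        exact le_abs_self γ
      have : 4 * (C * L ^ d) * L - (4 * C + |γ| + 1) * L ^ (d + 1) =
        -((|γ| + 1) * L ^ (d + 1)) := by ring
      linarith
    have h3 : 2 * Real.exp (-L) ≤ 1 := by
      rw [Real.exp_neg, ← div_eq_mul_inv, div_le_one (Real.exp_pos L)]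
      linarith [Real.add_one_le_exp L]
    nlinarith [Real.exp_pos (-(γ * L))]

/-- A set whose complement is small has large measure, without measurability assumptions. -/
lemma ofReal_one_sub_le_measure {Ω : Type*} [MeasurableSpace Ω] (P : Measure Ω)
    [IsProbabilityMeasure P] {s : Set Ω} {ε : ℝ} (hε : 0 ≤ ε) (h : P sᶜ ≤ ENNReal.ofReal ε) :
    ENNReal.ofReal (1 - ε) ≤ P s := by
  rw [ENNReal.ofReal_sub _ hε, ENNReal.ofReal_one, tsub_le_iff_right]
  calc 1 = P (s ∪ sᶜ) := by rw [Set.union_compl_self, measure_univ]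
    _ ≤ P s + P sᶜ := measure_union_le _ _
    _ ≤ _ := by gcongr

end Staircase

/-- Fix `d ≥ 2`.  For every `γ > 0` there is a constant `C = C(γ, d)` such that
for all `n ≥ 2` and points `q_1, …, q_n` sampled independently from `[0,1]^d`
with independent coordinates, the `j`-th coordinate drawn from an atomless
probability distribution `μ_j` on `[0,1]` (with `Q_i = {q_1, …, q_i}`): with
probability at least `1 - n^{-γ}` the union of the prefix staircases satisfies
`|⋃_i St(Q_i)| ≤ C·(ln n)^d`, and with probability at least `1 - n^{-γ}` the
staircase of the full set satisfies `|St(Q_n)| ≤ C·(ln n)^{d-1}`. -/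
theorem staircase_prefixes_whp (d : ℕ) (hd : 2 ≤ d) (γ : ℝ) (hγ : 0 < γ) :
    ∃ C : ℝ, 0 < C ∧
      ∀ n : ℕ, 2 ≤ n →
      ∀ μ : Fin d → Measure ℝ,
        (∀ j, IsProbabilityMeasure (μ j)) →
        (∀ j, ∀ a : ℝ, μ j {a} = 0) →
        (∀ j, μ j (Set.Icc (0 : ℝ) 1) = 1) →
        (ENNReal.ofReal (1 - (n : ℝ) ^ (-γ)) ≤
          Measure.pi (fun _ : Fin n => Measure.pi μ)
            {q : Fin n → Fin d → ℝ |
              (((⋃ i : Fin n, stair (q '' Set.Iic i)).ncard : ℝ)) ≤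
                C * Real.log n ^ d}) ∧
        (ENNReal.ofReal (1 - (n : ℝ) ^ (-γ)) ≤
          Measure.pi (fun _ : Fin n => Measure.pi μ)
            {q : Fin n → Fin d → ℝ |
              ((stair (Set.range q)).ncard : ℝ) ≤ C * Real.log n ^ (d - 1)}) := by

  obtain ⟨C₁, hC₁, h₁⟩ := Staircase.exists_measure_lt_recCount_le d γ
  obtain ⟨e, rfl⟩ : ∃ e, d = e + 1 := ⟨d - 1, by omega⟩
  obtain ⟨C₂, hC₂, h₂⟩ := Staircase.exists_measure_lt_recCount_le e γ
  refine ⟨(C₁ + C₂) * 3 ^ (e + 1), by positivity, fun n hn μ hμ _ _ => ?_⟩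
  have hn2 : (2 : ℝ) ≤ n := by exact_mod_cast hn
  have hlog : 1 / 2 ≤ Real.log n := by
    have := Real.log_le_log two_pos hn2
    linarith [Real.log_two_gt_d9]
  set L := Real.log n + 1 with hL
  have hL1 : 1 ≤ L := by linarith
  have hL0 : 0 ≤ L := by linarith
  have hL3 : L ≤ 3 * Real.log n := by linarith
  have hnL : (n : ℝ) ≤ Real.exp L := by
    rw [hL, Real.exp_add, Real.exp_log (by linarith)]
    nlinarith [Real.add_one_le_exp (1 : ℝ)]
  have hε : Real.exp (-(γ * L)) ≤ (n : ℝ) ^ (-γ) := by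
    rw [Real.rpow_def_of_pos (by linarith)]
    exact Real.exp_le_exp.2 (by nlinarith)
  have hb₁ : C₁ * L ^ (e + 1) ≤ (C₁ + C₂) * 3 ^ (e + 1) * Real.log n ^ (e + 1) := by
    rw [mul_assoc, ← mul_pow]
    gcongr
    linarith
  have hb₂ : C₂ * L ^ e ≤ (C₁ + C₂) * 3 ^ (e + 1) * Real.log n ^ e := by
    calc C₂ * L ^ e ≤ (C₁ + C₂) * (3 * Real.log n) ^ e := by
          gcongr
          linarith
      _ = (C₁ + C₂) * 3 ^ e * Real.log n ^ e := by rw [mul_pow]; ring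
      _ ≤ _ := by
          gcongr
          · norm_num
          · omega
  refine ⟨Staircase.ofReal_one_sub_le_measure _ (by positivity) ?_,
    Staircase.ofReal_one_sub_le_measure _ (by positivity) ?_⟩
  · have hmp := Staircase.measurePreserving_comp_of_injective (Measure.pi μ)
      (Fin.rev_injective (n := n))
    refine le_trans ?_ ((h₁ L hL1 n hnL μ hμ).trans (ENNReal.ofReal_le_ofReal hε))
    refine le_trans (measure_mono ?_) ((Measure.le_map_apply hmp.measurable.aemeasurable _).trans
      (by rw [hmp.map_eq]))
    intro q hq
    simp only [Set.mem_compl_iff, Set.mem_ofPred_eq, not_le] at hq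
    exact hb₁.trans_lt (hq.trans_le (Nat.cast_le.2 (Staircase.ncard_iUnion_stair_le_recCount q)))
  · refine le_trans (measure_mono ?_) ((Staircase.measure_lt_sortedRecCount_le μ _).trans
      ((h₂ L hL1 n hnL _ fun j => hμ j.succ).trans (ENNReal.ofReal_le_ofReal hε)))
    intro q hq
    simp only [Set.mem_compl_iff, Set.mem_ofPred_eq, not_le, Nat.add_sub_cancel] at hq
    exact hb₂.trans_lt
      (hq.trans_le (Nat.cast_le.2 (Staircase.ncard_stair_range_le_sortedRecCount q)))
end

section
/- Fix an integer d ≥ 1. For every γ > 0 there exists a constant C = C(γ, d) such that the following holds for all n ≥ 2. Let S = {s_1, …, s_n} be distinct sites in ℝ², and sample for each site a parametric point α_i ∈ [0,1]^d independently, with the d coordinates of each α_i independent and the j-th coordinate drawn from an atomless probability distribution μ_j on [0,1]. Then with probability at least 1 − n^{−γ} over this sampling, simultaneously for every point x ∈ ℝ², the candidate set satisfies |C(x)| ≤ C·(ln n)^d. -/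
open MeasureTheory

/-- The candidate set of `x`: indices `i` whose point `(α_i, dist(x, s_i))` is a
staircase point (Pareto minimum) of `{(α_1, ℓ_1), …, (α_n, ℓ_n)} ⊆ ℝ^{d+1}`. -/
def candSet {n d : ℕ} (s : Fin n → EuclideanSpace ℝ (Fin 2))
    (α : Fin n → Fin d → ℝ) (x : EuclideanSpace ℝ (Fin 2)) : Set (Fin n) :=
  {i | ∀ j : Fin n,
      (α j, dist x (s j)) ≠ (α i, dist x (s i)) →
      ¬((∀ m, α j m ≤ α i m) ∧ dist x (s j) ≤ dist x (s i))}

open scoped Classical in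
/-- The indices of the minimal points of a family (repeated points are not minimal). -/
noncomputable def minimaSet {X : Type*} [LE X] {n : ℕ} (p : Fin n → X) : Finset (Fin n) :=
  {i | ∀ j, j ≠ i → ¬ p j ≤ p i}

open scoped Classical in
/-- The number of points of a sequence that are not above any later point. -/
noncomputable def recordCount {X : Type*} [LE X] {n : ℕ} (p : Fin n → X) : ℕ :=
  Finset.card {i : Fin n | ∀ j, i < j → ¬ p j ≤ p i}

open scoped Classical in
/-- The number of records at which the remaining sequence has at most `K` minima. -/
noncomputable def truncRecordCount {X : Type*} [LE X] (K : ℝ) : {n : ℕ} → (Fin n → X) → ℕ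
  | 0, _ => 0
  | _ + 1, p => (if 0 ∈ minimaSet p ∧ ((minimaSet p).card : ℝ) ≤ K then 1 else 0) +
      truncRecordCount K (Fin.tail p)

section Combinatorics

variable {X : Type*} [LE X] {n : ℕ}

lemma mem_minimaSet {p : Fin n → X} {i : Fin n} :
    i ∈ minimaSet p ↔ ∀ j, j ≠ i → ¬ p j ≤ p i := by
  classical
  simp [minimaSet]

lemma mem_minimaSet_comp_perm {p : Fin n → X} (σ : Equiv.Perm (Fin n)) {i : Fin n} :
    i ∈ minimaSet (p ∘ σ) ↔ σ i ∈ minimaSet p := by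
  simp only [mem_minimaSet, Function.comp]
  exact ⟨fun h j hj => by simpa using h (σ.symm j) (by rintro rfl; simp at hj),
    fun h j hj => h (σ j) (by simpa using hj)⟩

lemma card_minimaSet_comp_perm (p : Fin n → X) (σ : Equiv.Perm (Fin n)) :
    (minimaSet (p ∘ σ)).card = (minimaSet p).card := by
  refine Finset.card_bij (fun i _ => σ i) (fun i hi => (mem_minimaSet_comp_perm σ).1 hi)
    (fun a _ b _ h => σ.injective h) fun b hb => ⟨σ.symm b, ?_, by simp⟩
  rw [mem_minimaSet_comp_perm]
  simpa using hb

open scoped Classical in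
lemma recordCount_succ (p : Fin (n + 1) → X) :
    recordCount p = (if 0 ∈ minimaSet p then 1 else 0) + recordCount (Fin.tail p) := by
  rw [recordCount, Fin.card_filter_univ_succ, recordCount]
  have h0 : (∀ j, (0 : Fin (n + 1)) < j → ¬ p j ≤ p 0) ↔ 0 ∈ minimaSet p := by
    simp [mem_minimaSet, Fin.pos_iff_ne_zero]
  have h1 : ∀ i : Fin n, (∀ j, i.succ < j → ¬ p j ≤ p i.succ) ↔
      ∀ j, i < j → ¬ Fin.tail p j ≤ Fin.tail p i := by
    intro i
    simp [Fin.forall_fin_succ, Fin.tail]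
  simp only [h0, h1]
  split_ifs <;> omega

lemma sum_two_pow_truncRecordCount_le {K : ℝ} (hK : 0 ≤ K) (p : Fin n → X) :
    ∑ σ : Equiv.Perm (Fin n), (2 : ℝ) ^ truncRecordCount K (p ∘ σ) ≤
      ∏ i ∈ Finset.range n, ((i : ℝ) + 1 + K) := by
  classical
  induction n with
  | zero => simp [truncRecordCount]
  | succ n ih =>
    rw [← Equiv.sum_comp Equiv.Perm.decomposeFin.symm, Fintype.sum_prod_type,
      Finset.prod_range_succ, mul_comm]
    set B := ∏ i ∈ Finset.range n, ((i : ℝ) + 1 + K) with hB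
    have hB0 : 0 ≤ B := Finset.prod_nonneg fun i _ => by positivity
    set c : Fin (n + 1) → ℝ := fun k =>
      if k ∈ minimaSet p ∧ ((minimaSet p).card : ℝ) ≤ K then 1 else 0 with hc
    have key : ∀ k : Fin (n + 1), ∑ e : Equiv.Perm (Fin n),
        (2 : ℝ) ^ truncRecordCount K (p ∘ Equiv.Perm.decomposeFin.symm (k, e)) ≤
          (1 + c k) * B := by
      intro k
      have h1 : ∀ e : Equiv.Perm (Fin n),
          (2 : ℝ) ^ truncRecordCount K (p ∘ Equiv.Perm.decomposeFin.symm (k, e)) =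
          (1 + c k) *
            2 ^ truncRecordCount K ((fun x : Fin n => p (Equiv.swap 0 k x.succ)) ∘ e) := by
        intro e
        have ht : Fin.tail (p ∘ Equiv.Perm.decomposeFin.symm (k, e)) =
            (fun x : Fin n => p (Equiv.swap 0 k x.succ)) ∘ e := by
          ext x
          simp [Fin.tail]
        simp only [truncRecordCount, ht, pow_add, mem_minimaSet_comp_perm,
          card_minimaSet_comp_perm, Equiv.Perm.decomposeFin_symm_apply_zero, hc]
        split_ifs <;> norm_num
      rw [Finset.sum_congr rfl fun e _ => h1 e, ← Finset.mul_sum]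
      refine mul_le_mul_of_nonneg_left (ih _) ?_
      simp only [hc]
      split_ifs <;> norm_num
    refine (Finset.sum_le_sum fun k _ => key k).trans ?_
    rw [← Finset.sum_mul]
    refine mul_le_mul_of_nonneg_right ?_ hB0
    rw [Finset.sum_add_distrib]
    have h2 : ∑ k, c k ≤ K := by
      by_cases h : ((minimaSet p).card : ℝ) ≤ K
      · simp [hc, h]
      · simpa [hc, h] using hK
    simp only [Finset.sum_const, Finset.card_univ, Fintype.card_fin, nsmul_eq_mul, mul_one]
    push_cast
    linarith

lemma prod_range_add_le {K : ℝ} (hK : 0 ≤ K) (n : ℕ) :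
    ∏ i ∈ Finset.range n, ((i : ℝ) + 1 + K) ≤
      n.factorial * Real.exp (K * (1 + Real.log n)) := by
  have h1 : ∏ i ∈ Finset.range n, ((i : ℝ) + 1 + K) ≤
      n.factorial * Real.exp (K * (harmonic n : ℚ)) := by
    rw [harmonic]
    push_cast
    rw [Finset.mul_sum, Real.exp_sum, ← Finset.prod_range_add_one_eq_factorial]
    push_cast
    rw [← Finset.prod_mul_distrib]
    refine Finset.prod_le_prod (fun i _ => by positivity) fun i _ => ?_
    have hi : (0 : ℝ) < (i : ℝ) + 1 := by positivity
    have := Real.add_one_le_exp (K * ((i : ℝ) + 1)⁻¹)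
    calc (i : ℝ) + 1 + K = ((i : ℝ) + 1) * (K * ((i : ℝ) + 1)⁻¹ + 1) := by field_simp; ring
      _ ≤ _ := by gcongr
  refine h1.trans ?_
  have := harmonic_le_one_add_log n
  gcongr

/-- Sorting by a first coordinate turns minima into records of the other coordinates. -/
lemma card_minimaSet_eq_recordCount {d : ℕ} (p : Fin n → Fin (d + 1) → ℝ)
    (hp : Function.Injective fun i => p i 0) :
    (minimaSet p).card =
      recordCount ((fun i => Fin.tail (p i)) ∘ Tuple.sort fun i => -p i 0) := by
  classical
  set σ := Tuple.sort fun i => -p i 0 with hσ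
  have hmono : ∀ i j, i ≤ j → p (σ j) 0 ≤ p (σ i) 0 := fun i j hij => by
    simpa using Tuple.monotone_sort (fun i => -p i 0) hij
  rw [← card_minimaSet_comp_perm p σ, recordCount, minimaSet]
  congr 1
  ext i
  simp only [Finset.mem_filter, Finset.mem_univ, true_and, Function.comp]
  have hle : ∀ j, p (σ j) ≤ p (σ i) ↔
      p (σ j) 0 ≤ p (σ i) 0 ∧ Fin.tail (p (σ j)) ≤ Fin.tail (p (σ i)) := fun j => by
    simp [Pi.le_def, Fin.forall_fin_succ, Fin.tail]
  simp only [hle]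
  constructor
  · intro h j hij ht
    exact h j hij.ne' ⟨hmono _ _ hij.le, ht⟩
  · rintro h j hij ⟨h0, ht⟩
    rcases lt_or_gt_of_ne hij with hlt | hlt
    · exact hij (σ.injective (hp (le_antisymm h0 (hmono _ _ hlt.le))))
    · exact h j hlt ht

lemma recordCount_le_one [Subsingleton X] (hX : ∀ x : X, x ≤ x) (p : Fin n → X) :
    recordCount p ≤ 1 := by
  classical
  rw [recordCount, Finset.card_le_one]
  have hle : ∀ i j, p i ≤ p j := fun i j => Subsingleton.elim (p i) (p j) ▸ hX _
  intro a ha b hb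
  simp only [hle, Finset.mem_filter, Finset.mem_univ, true_and, not_true_eq_false,
    imp_false, not_lt] at ha hb
  exact le_antisymm (hb a) (ha b)

end Combinatorics

section Measure

variable {n d : ℕ}

lemma measurableSet_mem_minimaSet (i : Fin n) :
    MeasurableSet {p : Fin n → Fin d → ℝ | i ∈ minimaSet p} := by
  simp only [mem_minimaSet, Set.ofPred_forall]
  refine MeasurableSet.iInter fun j => MeasurableSet.iInter fun _ => ?_
  exact (measurableSet_le (measurable_pi_apply j) (measurable_pi_apply i)).compl

lemma measurable_card_minimaSet :
    Measurable fun p : Fin n → Fin d → ℝ => ((minimaSet p).card : ℝ) := by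
  classical
  have h : (fun p : Fin n → Fin d → ℝ => ((minimaSet p).card : ℝ)) =
      fun p => ∑ i, if i ∈ minimaSet p then (1 : ℝ) else 0 := by
    ext p
    simp
  rw [h]
  exact Finset.measurable_sum _ fun i _ =>
    Measurable.ite (measurableSet_mem_minimaSet i) measurable_const measurable_const

lemma measurable_truncRecordCount (K : ℝ) :
    Measurable fun p : Fin n → Fin d → ℝ => truncRecordCount K p := by
  classical
  induction n with
  | zero => exact measurable_const
  | succ n ih =>
    simp only [truncRecordCount]
    refine Measurable.add (Measurable.ite ?_ measurable_const measurable_const) (ih.comp ?_)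
    · exact (measurableSet_mem_minimaSet 0).inter
        (measurableSet_le measurable_card_minimaSet measurable_const)
    · exact measurable_pi_lambda _ fun i => measurable_pi_apply _

lemma measurePreserving_comp_perm_s19 {X : Type*} [MeasurableSpace X] (ν : Measure X)
    [SigmaFinite ν] (σ : Equiv.Perm (Fin n)) :
    MeasurePreserving (fun p : Fin n → X => p ∘ σ)
      (Measure.pi fun _ => ν) (Measure.pi fun _ => ν) :=
  measurePreserving_arrowCongr' (fun _ => ν) (fun _ => ν) σ.symm (MeasurableEquiv.refl X)
    fun _ => MeasurePreserving.id ν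

lemma measurePreserving_tail {X : Type*} [MeasurableSpace X] (ν : Measure X)
    [IsProbabilityMeasure ν] :
    MeasurePreserving (fun p : Fin (n + 1) → X => (Fin.tail p : Fin n → X))
      (Measure.pi fun _ => ν) (Measure.pi fun _ => ν) :=
  measurePreserving_snd.comp (measurePreserving_piFinSuccAbove (fun _ => ν) 0)

lemma ae_injective_pi (m : Measure ℝ) [IsProbabilityMeasure m] (hm : ∀ a, m {a} = 0) :
    ∀ᵐ a ∂Measure.pi fun _ : Fin n => m, Function.Injective a := by
  have hij : ∀ i j : Fin n, i ≠ j → ∀ᵐ a ∂Measure.pi fun _ : Fin n => m, a i ≠ a j := by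
    intro i j hij
    cases n with
    | zero => exact i.elim0
    | succ n =>
      obtain ⟨k, rfl⟩ := Fin.exists_succAbove_eq hij.symm
      have hmp := measurePreserving_piFinSuccAbove (fun _ : Fin (n + 1) => m) i
      have hs : MeasurableSet {q : ℝ × (Fin n → ℝ) | q.1 = q.2 k} :=
        measurableSet_eq_fun measurable_fst ((measurable_pi_apply k).comp measurable_snd)
      have h0 : (m.prod (Measure.pi fun _ : Fin n => m)) {q | q.1 = q.2 k} = 0 := by
        rw [Measure.prod_apply_symm hs]
        simp [hm]
      rw [← hmp.measure_preimage hs.nullMeasurableSet] at h0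
      rw [ae_iff]
      simp only [ne_eq, not_not]
      exact h0
  have hall : ∀ᵐ a ∂Measure.pi fun _ : Fin n => m, ∀ i j, i ≠ j → a i ≠ a j := by
    simp only [ae_all_iff]
    exact hij
  filter_upwards [hall] with a ha i j h
  by_contra hne
  exact ha i j hne h

lemma lintegral_two_pow_truncRecordCount_le {K : ℝ} (hK : 0 ≤ K) (ν : Measure (Fin d → ℝ))
    [IsProbabilityMeasure ν] :
    ∫⁻ p : Fin n → Fin d → ℝ, ENNReal.ofReal (2 ^ truncRecordCount K p) ∂Measure.pi (fun _ => ν) ≤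
      ENNReal.ofReal (Real.exp (K * (1 + Real.log n))) := by
  set f : (Fin n → Fin d → ℝ) → ENNReal := fun p => ENNReal.ofReal (2 ^ truncRecordCount K p)
    with hf
  have hfm : Measurable f :=
    ENNReal.measurable_ofReal.comp ((measurable_of_countable fun k : ℕ => (2 : ℝ) ^ k).comp
      (measurable_truncRecordCount K))
  have h1 : (n.factorial : ENNReal) * ∫⁻ p, f p ∂Measure.pi (fun _ => ν) =
      ∫⁻ p, ∑ σ : Equiv.Perm (Fin n), f (p ∘ σ) ∂Measure.pi (fun _ => ν) := by
    rw [lintegral_finsetSum (f := fun (σ : Equiv.Perm (Fin n)) p => f (p ∘ σ)) _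
        fun σ _ => hfm.comp (measurePreserving_comp_perm_s19 ν σ).measurable,
      Finset.sum_congr rfl fun σ _ => (measurePreserving_comp_perm_s19 ν σ).lintegral_comp hfm]
    simp [Fintype.card_perm]
  have h2 : ∫⁻ p, ∑ σ : Equiv.Perm (Fin n), f (p ∘ σ) ∂Measure.pi (fun _ => ν) ≤
      (n.factorial : ENNReal) * ENNReal.ofReal (Real.exp (K * (1 + Real.log n))) := by
    calc _ ≤ ∫⁻ _ : Fin n → Fin d → ℝ,
          (n.factorial : ENNReal) * ENNReal.ofReal (Real.exp (K * (1 + Real.log n)))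
          ∂Measure.pi (fun _ => ν) := by
          refine lintegral_mono fun p => ?_
          simp only [hf]
          rw [← ENNReal.ofReal_sum_of_nonneg fun _ _ => by positivity,
            ← ENNReal.ofReal_natCast, ← ENNReal.ofReal_mul (by positivity)]
          exact ENNReal.ofReal_le_ofReal
            ((sum_two_pow_truncRecordCount_le hK p).trans (prod_range_add_le hK n))
      _ = _ := by simp
  rw [← h1] at h2
  exact (ENNReal.mul_le_mul_iff_right (by exact_mod_cast n.factorial_ne_zero)
    (ENNReal.natCast_ne_top _)).1 h2

lemma measure_lt_truncRecordCount_le {K : ℝ} (hK : 0 ≤ K) (R : ℝ) (ν : Measure (Fin d → ℝ))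
    [IsProbabilityMeasure ν] :
    Measure.pi (fun _ : Fin n => ν) {p | R < truncRecordCount K p} ≤
      ENNReal.ofReal (Real.exp (K * (1 + Real.log n) - R * Real.log 2)) := by
  have hfm : Measurable fun p : Fin n → Fin d → ℝ =>
      ENNReal.ofReal (2 ^ truncRecordCount K p) :=
    ENNReal.measurable_ofReal.comp ((measurable_of_countable fun k : ℕ => (2 : ℝ) ^ k).comp
      (measurable_truncRecordCount K))
  have h := (mul_meas_ge_le_lintegral (μ := Measure.pi fun _ : Fin n => ν) hfm
    (ENNReal.ofReal (Real.exp (R * Real.log 2)))).trans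
    (lintegral_two_pow_truncRecordCount_le hK ν)
  have hsub : {p : Fin n → Fin d → ℝ | R < truncRecordCount K p} ⊆
      {p | ENNReal.ofReal (Real.exp (R * Real.log 2)) ≤
        ENNReal.ofReal (2 ^ truncRecordCount K p)} := by
    intro p hp
    refine ENNReal.ofReal_le_ofReal ?_
    have h2 : (2 : ℝ) ^ truncRecordCount K p =
        Real.exp (truncRecordCount K p * Real.log 2) := by
      rw [Real.exp_nat_mul, Real.exp_log two_pos]
    have hl : 0 ≤ Real.log 2 := Real.log_nonneg one_le_two
    have hR : R ≤ truncRecordCount K p := le_of_lt hp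
    rw [h2]
    gcongr
  refine (measure_mono hsub).trans ?_
  rw [Real.exp_sub, ENNReal.ofReal_div_of_pos (Real.exp_pos _),
    ENNReal.le_div_iff_mul_le (Or.inl (by simp [Real.exp_pos])) (Or.inl (by simp)), mul_comm]
  exact h

lemma measure_recordCount_ne_truncRecordCount_le (K : ℝ) (ν : Measure (Fin d → ℝ))
    [IsProbabilityMeasure ν] (ε : ENNReal)
    (hε : ∀ m ≤ n, Measure.pi (fun _ : Fin m => ν) {p | K < ((minimaSet p).card : ℝ)} ≤ ε) :
    Measure.pi (fun _ : Fin n => ν) {p | recordCount p ≠ truncRecordCount K p} ≤ n * ε := by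
  classical
  induction n with
  | zero => simp [truncRecordCount, recordCount]
  | succ n ih =>
    have hsub : {p : Fin (n + 1) → Fin d → ℝ | recordCount p ≠ truncRecordCount K p} ⊆
        (Fin.tail ⁻¹' {p | recordCount p ≠ truncRecordCount K p}) ∪
          {p | K < ((minimaSet p).card : ℝ)} := by
      intro p hp
      by_contra hcon
      simp only [Set.mem_union, Set.mem_preimage, Set.mem_ofPred_eq, not_or, not_not,
        not_lt] at hcon
      apply hp
      simp [recordCount_succ, truncRecordCount, hcon.1, hcon.2]
    have hmp := measurePreserving_tail (n := n) ν
    have h1 := hmp.measure_preimage_le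
      {p | recordCount p ≠ truncRecordCount K p}
    calc _ ≤ _ := measure_mono hsub
      _ ≤ _ := measure_union_le _ _
      _ ≤ n * ε + ε := add_le_add (h1.trans (ih fun m hm => hε m (by omega))) (hε _ le_rfl)
      _ = _ := by push_cast; ring

instance isProbabilityMeasure_tail (μ : Fin (d + 1) → Measure ℝ)
    [∀ j, IsProbabilityMeasure (μ j)] (j : Fin d) : IsProbabilityMeasure (Fin.tail μ j) :=
  inferInstanceAs (IsProbabilityMeasure (μ j.succ))

lemma measurePreserving_unconsCoords (μ : Fin (d + 1) → Measure ℝ)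
    [∀ j, IsProbabilityMeasure (μ j)] :
    MeasurePreserving
      (fun p : Fin n → Fin (d + 1) → ℝ =>
        ((fun i => p i 0, fun i => Fin.tail (p i)) : (Fin n → ℝ) × (Fin n → Fin d → ℝ)))
      (Measure.pi fun _ => Measure.pi μ)
      ((Measure.pi fun _ => μ 0).prod (Measure.pi fun _ => Measure.pi (Fin.tail μ))) :=
  (measurePreserving_arrowProdEquivProdArrow ℝ (Fin d → ℝ) (Fin n) (fun _ => μ 0)
    fun _ => Measure.pi (Fin.tail μ)).comp
    (measurePreserving_pi (fun _ => Measure.pi μ)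
      (fun _ => (μ 0).prod (Measure.pi (Fin.tail μ)))
      fun _ => measurePreserving_piFinSuccAbove μ 0)

lemma measure_lt_card_minimaSet_le (μ : Fin (d + 1) → Measure ℝ)
    [∀ j, IsProbabilityMeasure (μ j)] (hμ : ∀ a, μ 0 {a} = 0) (K : ℝ) :
    Measure.pi (fun _ : Fin n => Measure.pi μ) {p | K < ((minimaSet p).card : ℝ)} ≤
      Measure.pi (fun _ : Fin n => Measure.pi (Fin.tail μ)) {p | K < recordCount p} := by
  set T : Set ((Fin n → ℝ) × (Fin n → Fin d → ℝ)) :=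
    {q | K < ((minimaSet fun i => (Fin.cons (q.1 i) (q.2 i) : Fin (d + 1) → ℝ)).card : ℝ)}
    with hT
  have hTm : MeasurableSet T := by
    refine measurableSet_lt measurable_const (measurable_card_minimaSet.comp ?_)
    refine measurable_pi_lambda _ fun i => measurable_pi_lambda _ fun j => ?_
    refine Fin.cases ?_ (fun j => ?_) j
    · simpa [Function.comp_def] using (measurable_pi_apply i).comp measurable_fst
    · simpa [Function.comp_def] using
        (measurable_pi_apply j).comp ((measurable_pi_apply i).comp measurable_snd)
  have hpre : {p : Fin n → Fin (d + 1) → ℝ | K < ((minimaSet p).card : ℝ)} =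
      (fun p : Fin n → Fin (d + 1) → ℝ =>
        ((fun i => p i 0, fun i => Fin.tail (p i)) : (Fin n → ℝ) × (Fin n → Fin d → ℝ))) ⁻¹' T := by
    ext p
    simp [hT]
  rw [hpre, (measurePreserving_unconsCoords μ).measure_preimage hTm.nullMeasurableSet,
    Measure.prod_apply hTm]
  set c := Measure.pi (fun _ : Fin n => Measure.pi (Fin.tail μ)) {p | K < recordCount p}
  have hslice : ∀ᵐ a ∂Measure.pi fun _ : Fin n => μ 0,
      Measure.pi (fun _ : Fin n => Measure.pi (Fin.tail μ)) (Prod.mk a ⁻¹' T) ≤ c := by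
    filter_upwards [ae_injective_pi (n := n) (μ 0) hμ] with a ha
    have hmp := measurePreserving_comp_perm_s19 (Measure.pi (Fin.tail μ)) (Tuple.sort fun i => -a i)
    have h1 := hmp.measure_preimage_le {p | K < recordCount p}
    refine le_trans (measure_mono fun b hb => ?_) h1
    simp only [hT, Set.mem_preimage, Set.mem_ofPred_eq] at hb ⊢
    rw [card_minimaSet_eq_recordCount _ (by simpa using ha)] at hb
    simpa using hb
  calc _ ≤ ∫⁻ _, c ∂Measure.pi (fun _ : Fin n => μ 0) := lintegral_mono_ae hslice
    _ = c := by simp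

end Measure

lemma half_le_log_two : (1 : ℝ) / 2 ≤ Real.log 2 := by
  have := Real.log_two_gt_d9
  linarith

lemma two_mul_rpow_neg_le {N : ℝ} (hN : 2 ≤ N) (γ : ℝ) :
    N ^ (-(γ + 1)) + N ^ (-(γ + 1)) ≤ N ^ (-γ) := by
  have h0 : 0 < N := by linarith
  have h : N ^ (-γ) = N ^ (-(γ + 1)) * N := by
    rw [← Real.rpow_add_one h0.ne']
    ring_nf
  have h1 : 0 < N ^ (-(γ + 1)) := Real.rpow_pos_of_pos h0 _
  rw [h]
  nlinarith

/-- The number of records of at most `N` random points is polylogarithmic in `N` with high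
probability. -/
theorem measure_lt_recordCount_le (d : ℕ) : ∀ γ : ℝ, 0 < γ → ∃ C : ℝ, 0 < C ∧
    ∀ N : ℕ, 2 ≤ N → ∀ n ≤ N, ∀ μ : Fin d → Measure ℝ,
      (∀ j, IsProbabilityMeasure (μ j)) → (∀ j, ∀ a : ℝ, μ j {a} = 0) →
      Measure.pi (fun _ : Fin n => Measure.pi μ) {p | C * Real.log N ^ d < recordCount p} ≤
        ENNReal.ofReal ((N : ℝ) ^ (-γ)) := by
  induction d with
  | zero =>
    intro γ _
    refine ⟨1, one_pos, fun N _ n _ μ _ _ => ?_⟩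
    have h : {p : Fin n → Fin 0 → ℝ | 1 * Real.log N ^ 0 < recordCount p} = ∅ := by
      ext p
      have := recordCount_le_one (fun x => le_refl x) p
      have : (recordCount p : ℝ) ≤ 1 := by exact_mod_cast this
      simpa using this
    rw [h]
    simp
  | succ d ih =>
    intro γ hγ
    obtain ⟨C, hC, hprob⟩ := ih (γ + 2) (by linarith)
    refine ⟨6 * C + 2 * (γ + 1) * 2 ^ d, by positivity, fun N hN n hn μ hμ hμ0 => ?_⟩
    have hN2 : (2 : ℝ) ≤ N := by exact_mod_cast hN
    have hN0 : (0 : ℝ) < N := by linarith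
    set L := Real.log N with hL
    have hL2 : 1 / 2 ≤ L := half_le_log_two.trans (Real.log_le_log two_pos hN2)
    have hL0 : 0 < L := by linarith
    set K := C * L ^ d with hK
    have hK0 : 0 < K := by positivity
    set R := (6 * C + 2 * (γ + 1) * 2 ^ d) * L ^ (d + 1) with hR
    have hR0 : 0 ≤ R := by positivity
    have hmin : ∀ m ≤ n, Measure.pi (fun _ : Fin m => Measure.pi μ)
        {p | K < ((minimaSet p).card : ℝ)} ≤ ENNReal.ofReal ((N : ℝ) ^ (-(γ + 2))) :=
      fun m hm => (measure_lt_card_minimaSet_le μ (hμ0 0) K).trans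
        (hprob N hN m (hm.trans hn) (Fin.tail μ) (fun j => hμ j.succ) fun j => hμ0 j.succ)
    have h1 := measure_recordCount_ne_truncRecordCount_le K (Measure.pi μ) _ hmin
    have h1' : (n : ENNReal) * ENNReal.ofReal ((N : ℝ) ^ (-(γ + 2))) ≤
        ENNReal.ofReal ((N : ℝ) ^ (-(γ + 1))) := by
      rw [← ENNReal.ofReal_natCast, ← ENNReal.ofReal_mul (by positivity)]
      refine ENNReal.ofReal_le_ofReal ?_
      have h : (N : ℝ) ^ (-(γ + 1)) = N * (N : ℝ) ^ (-(γ + 2)) := by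
        rw [mul_comm, ← Real.rpow_add_one hN0.ne']
        ring_nf
      rw [h]
      gcongr
    have h2 := measure_lt_truncRecordCount_le (n := n) hK0.le R (Measure.pi μ)
    have hexp : Real.exp (K * (1 + Real.log n) - R * Real.log 2) ≤
        (N : ℝ) ^ (-(γ + 1)) := by
      rw [Real.rpow_def_of_pos hN0]
      refine Real.exp_le_exp.2 ?_
      have hln : Real.log n ≤ L := by
        rcases Nat.eq_zero_or_pos n with rfl | hpos
        · simpa using hL0.le
        · exact Real.log_le_log (by exact_mod_cast hpos) (by exact_mod_cast hn)
      have e1 : K * (1 + Real.log n) ≤ 3 * (K * L) := by nlinarith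
      have e2 : R * (1 / 2) ≤ R * Real.log 2 :=
        mul_le_mul_of_nonneg_left half_le_log_two hR0
      have e3 : R * (1 / 2) = 3 * (K * L) + (γ + 1) * (2 * L) ^ d * L := by
        rw [hR, hK, mul_pow]
        ring
      have e4 : (1 : ℝ) ≤ (2 * L) ^ d := one_le_pow₀ (by linarith)
      have e5 : (γ + 1) * 1 * L ≤ (γ + 1) * (2 * L) ^ d * L := by gcongr
      linarith
    have hsub : {p : Fin n → Fin (d + 1) → ℝ | R < recordCount p} ⊆
        {p | recordCount p ≠ truncRecordCount K p} ∪ {p | R < truncRecordCount K p} := by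
      intro p hp
      by_cases h : recordCount p = truncRecordCount K p
      · right
        simpa only [Set.mem_ofPred_eq, h] using hp
      · exact Or.inl h
    calc _ ≤ _ := measure_mono hsub
      _ ≤ _ := measure_union_le _ _
      _ ≤ ENNReal.ofReal ((N : ℝ) ^ (-(γ + 1))) + ENNReal.ofReal ((N : ℝ) ^ (-(γ + 1))) :=
        add_le_add (h1.trans h1') (h2.trans (ENNReal.ofReal_le_ofReal hexp))
      _ = ENNReal.ofReal ((N : ℝ) ^ (-(γ + 1)) + (N : ℝ) ^ (-(γ + 1))) :=
        (ENNReal.ofReal_add (by positivity) (by positivity)).symm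
      _ ≤ _ := ENNReal.ofReal_le_ofReal (two_mul_rpow_neg_le hN2 γ)

section Orders

variable {n : ℕ}

open scoped Classical in
/-- The pairs of sites `(i, j)` such that `x` is at most as far from `i` as from `j`. -/
noncomputable def distPattern (s : Fin n → EuclideanSpace ℝ (Fin 2))
    (x : EuclideanSpace ℝ (Fin 2)) : Finset (Fin n × Fin n) :=
  {e | dist x (s e.1) ≤ dist x (s e.2)}

open scoped Classical in
/-- All distance patterns realised by points of the plane. -/
noncomputable def distPatterns (s : Fin n → EuclideanSpace ℝ (Fin 2)) :
    Finset (Finset (Fin n × Fin n)) :=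
  {F | ∃ x, distPattern s x = F}

lemma mem_distPattern {s : Fin n → EuclideanSpace ℝ (Fin 2)} {x : EuclideanSpace ℝ (Fin 2)}
    {e : Fin n × Fin n} :
    e ∈ distPattern s x ↔ dist x (s e.1) ^ 2 - dist x (s e.2) ^ 2 ≤ 0 := by
  classical
  simp [distPattern, sq_le_sq₀ dist_nonneg dist_nonneg]

lemma mem_distPatterns {s : Fin n → EuclideanSpace ℝ (Fin 2)} {F : Finset (Fin n × Fin n)} :
    F ∈ distPatterns s ↔ ∃ x, distPattern s x = F := by
  classical
  simp [distPatterns]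

lemma card_le_three_of_shatters (s : Fin n → EuclideanSpace ℝ (Fin 2))
    {A : Finset (Fin n × Fin n)} (hA : (distPatterns s).Shatters A) : A.card ≤ 3 := by
  by_contra! hcard
  set v : A → Fin 3 → ℝ := fun e =>
    ![s e.1.1 0 - s e.1.2 0, s e.1.1 1 - s e.1.2 1,
      s e.1.1 0 ^ 2 + s e.1.1 1 ^ 2 - (s e.1.2 0 ^ 2 + s e.1.2 1 ^ 2)] with hv
  have hdep : ¬ LinearIndependent ℝ v := fun h => by
    have := h.fintype_card_le_finrank
    simp at this
    omega
  obtain ⟨g, hg, k, hk⟩ : ∃ g : A → ℝ, ∑ e, g e • v e = 0 ∧ ∃ k, 0 < g k := by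
    obtain ⟨g, hg, k, hk⟩ := Fintype.not_linearIndependent_iff.1 hdep
    rcases lt_or_gt_of_ne hk with h | h
    · refine ⟨-g, ?_, k, by simpa using h⟩
      simpa only [Pi.neg_apply, neg_smul, Finset.sum_neg_distrib, neg_eq_zero] using hg
    · exact ⟨g, hg, k, h⟩
  obtain ⟨F, hF, hAF⟩ := hA (Finset.filter_subset (fun e => ∃ h : e ∈ A, g ⟨e, h⟩ ≤ 0) A)
  obtain ⟨x, rfl⟩ := mem_distPatterns.1 hF
  set f : A → ℝ := fun e => dist x (s e.1.1) ^ 2 - dist x (s e.1.2) ^ 2 with hf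
  have hiff : ∀ e : A, f e ≤ 0 ↔ g e ≤ 0 := by
    intro e
    have := Finset.ext_iff.1 hAF e.1
    simpa [mem_distPattern, hf] using this
  have hsum : ∑ e, g e * f e = 0 := by
    have h := fun m => congrFun hg m
    have hfe : ∀ e, g e * f e = -2 * x 0 * (g e • v e) 0 - 2 * x 1 * (g e • v e) 1 +
        (g e • v e) 2 := by
      intro e
      simp only [hf, hv, EuclideanSpace.dist_eq, Fin.sum_univ_two, Real.dist_eq, sq_abs]
      rw [Real.sq_sqrt (by positivity), Real.sq_sqrt (by positivity)]
      simp
      ring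
    rw [Finset.sum_congr rfl fun e _ => hfe e, Finset.sum_add_distrib, Finset.sum_sub_distrib,
      ← Finset.mul_sum, ← Finset.mul_sum]
    simp only [← Finset.sum_apply, hg]
    simp
  have hpos : 0 < ∑ e, g e * f e := by
    refine Finset.sum_pos' (fun e _ => ?_) ⟨k, Finset.mem_univ _, ?_⟩
    · by_cases h : g e ≤ 0
      · exact mul_nonneg_of_nonpos_of_nonpos h ((hiff e).2 h)
      · have h' : 0 < f e := not_le.1 fun hc => h ((hiff e).1 hc)
        exact mul_nonneg (not_le.1 h).le h'.le
    · exact mul_pos hk (not_le.1 fun hc => hk.not_ge ((hiff k).1 hc))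
  exact hpos.ne' hsum

lemma card_distPatterns_le (s : Fin n → EuclideanSpace ℝ (Fin 2)) (hn : 2 ≤ n) :
    (distPatterns s).card ≤ n ^ 8 := by
  have hvc : (distPatterns s).vcDim ≤ 3 :=
    Finset.sup_le fun A hA => card_le_three_of_shatters s (Finset.mem_shatterer.1 hA)
  have hN : 1 ≤ n ^ 2 := Nat.one_le_pow _ _ (by omega)
  calc (distPatterns s).card ≤ (distPatterns s).shatterer.card := Finset.card_le_card_shatterer _
    _ ≤ ∑ k ∈ Finset.Iic (distPatterns s).vcDim, (Fintype.card (Fin n × Fin n)).choose k :=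
      Finset.card_shatterer_le_sum_vcDim
    _ ≤ ∑ k ∈ Finset.Iic 3, (Fintype.card (Fin n × Fin n)).choose k :=
      Finset.sum_le_sum_of_subset (Finset.Iic_subset_Iic.2 hvc)
    _ ≤ ∑ k ∈ Finset.Iic 3, (n ^ 2) ^ 3 := by
      refine Finset.sum_le_sum fun k hk => ?_
      rw [Fintype.card_prod, Fintype.card_fin, ← sq]
      exact (Nat.choose_le_pow _ _).trans (Nat.pow_le_pow_right hN (Finset.mem_Iic.1 hk))
    _ = 2 ^ 2 * n ^ 6 := by
      simp
      ring
    _ ≤ n ^ 2 * n ^ 6 := by gcongr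
    _ = n ^ 8 := by ring

/-- Up to ties in the parametric points, candidates are records of the sites listed by
decreasing distance. -/
lemma ncard_candSet_le_recordCount {d : ℕ} (s : Fin n → EuclideanSpace ℝ (Fin 2))
    {α : Fin n → Fin d → ℝ} (hα : Function.Injective α) (x : EuclideanSpace ℝ (Fin 2))
    (σ : Equiv.Perm (Fin n))
    (hσ : ∀ i j, i ≤ j → dist x (s (σ j)) ≤ dist x (s (σ i))) :
    (candSet s α x).ncard ≤ recordCount (α ∘ σ) := by
  classical
  rw [recordCount, ← Set.ncard_coe_finset]
  refine Set.ncard_le_ncard_of_injOn σ.symm (fun i hi => ?_) σ.symm.injective.injOn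
    (Finset.finite_toSet _)
  simp only [Finset.coe_filter, Finset.mem_univ, true_and, Set.mem_ofPred_eq, Function.comp,
    Equiv.apply_symm_apply]
  intro j hj hle
  refine hi (σ j) (fun heq => ?_) ⟨hle, by simpa using hσ _ _ hj.le⟩
  have hij : σ j = i := hα (congrArg Prod.fst heq)
  simp [← hij] at hj

lemma exists_perm_of_mem_distPatterns (s : Fin n → EuclideanSpace ℝ (Fin 2))
    (F : Finset (Fin n × Fin n)) : ∃ σ : Equiv.Perm (Fin n), ∀ x, distPattern s x = F →
      ∀ i j, i ≤ j → dist x (s (σ j)) ≤ dist x (s (σ i)) := by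
  classical
  by_cases hF : ∃ y, distPattern s y = F
  · obtain ⟨y, hy⟩ := hF
    refine ⟨Tuple.sort fun i => -dist y (s i), fun x hx i j hij => ?_⟩
    have h := Tuple.monotone_sort (fun i => -dist y (s i)) hij
    have h1 : (Tuple.sort (fun i => -dist y (s i)) j, Tuple.sort (fun i => -dist y (s i)) i) ∈
        distPattern s y := by
      simpa [distPattern] using h
    rw [hy, ← hx] at h1
    simpa [distPattern] using h1
  · exact ⟨1, fun x hx => absurd ⟨x, hx⟩ hF⟩

end Orders

/-- Fix `d ≥ 1`.  For every `γ > 0` there is a constant `C = C(γ, d)` such that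
for all `n ≥ 2`, distinct sites in the plane, and parametric points sampled
coordinatewise-independently from atomless distributions on `[0,1]`: with
probability at least `1 - n^{-γ}`, simultaneously for every `x ∈ ℝ²`, the
candidate set satisfies `|C(x)| ≤ C·(ln n)^d`. -/
theorem candidate_set_size_whp (d : ℕ) (hd : 1 ≤ d) (γ : ℝ) (hγ : 0 < γ) :
    ∃ C : ℝ, 0 < C ∧
      ∀ n : ℕ, 2 ≤ n →
      ∀ s : Fin n → EuclideanSpace ℝ (Fin 2), Function.Injective s →
      ∀ μ : Fin d → Measure ℝ,
        (∀ j, IsProbabilityMeasure (μ j)) →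
        (∀ j, ∀ a : ℝ, μ j {a} = 0) →
        (∀ j, μ j (Set.Icc (0 : ℝ) 1) = 1) →
        ENNReal.ofReal (1 - (n : ℝ) ^ (-γ)) ≤
          Measure.pi (fun _ : Fin n => Measure.pi μ)
            {α : Fin n → Fin d → ℝ |
              ∀ x : EuclideanSpace ℝ (Fin 2),
                ((candSet s α x).ncard : ℝ) ≤ C * Real.log n ^ d} := by
  obtain ⟨C, hC, hprob⟩ := measure_lt_recordCount_le d (γ + 8) (by linarith)
  refine ⟨C, hC, fun n hn s _ μ hμ hμ0 _ => ?_⟩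
  have hn0 : (0 : ℝ) < n := by exact_mod_cast (by omega : 0 < n)
  set P := Measure.pi (fun _ : Fin n => Measure.pi μ)
  set R := C * Real.log n ^ d with hR
  set G : Set (Fin n → Fin d → ℝ) := {α | ∀ x, ((candSet s α x).ncard : ℝ) ≤ R} with hG
  choose σ hσ using exists_perm_of_mem_distPatterns s
  have hinj : P {α | ¬ Function.Injective α} = 0 := by
    have hmp : MeasurePreserving (fun (α : Fin n → Fin d → ℝ) i => α i ⟨0, hd⟩) P
        (Measure.pi fun _ => μ ⟨0, hd⟩) :=
      measurePreserving_pi _ _ fun _ => measurePreserving_eval μ ⟨0, hd⟩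
    have h := hmp.quasiMeasurePreserving.ae (ae_injective_pi (n := n) _ (hμ0 ⟨0, hd⟩))
    refine ae_iff.1 (h.mono fun α hα i j hij => hα ?_)
    simp [hij]
  have hsub : Gᶜ ⊆ {α | ¬ Function.Injective α} ∪
      ⋃ F ∈ distPatterns s, (fun α => α ∘ σ F) ⁻¹' {p | R < recordCount p} := by
    intro α hα
    by_cases hi : Function.Injective α
    · right
      simp only [hG, Set.mem_compl_iff, Set.mem_ofPred_eq, not_forall, not_le] at hα
      obtain ⟨x, hx⟩ := hα
      simp only [Set.mem_iUnion]
      refine ⟨distPattern s x, mem_distPatterns.2 ⟨x, rfl⟩, hx.trans_le ?_⟩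
      exact_mod_cast ncard_candSet_le_recordCount s hi x _ (hσ _ x rfl)
    · exact Or.inl hi
  have hbad : P Gᶜ ≤ ENNReal.ofReal ((n : ℝ) ^ (-γ)) := by
    calc P Gᶜ ≤ _ := measure_mono hsub
      _ ≤ _ := measure_union_le _ _
      _ ≤ 0 + ∑ F ∈ distPatterns s, ENNReal.ofReal ((n : ℝ) ^ (-(γ + 8))) := by
        refine add_le_add hinj.le ((measure_biUnion_finset_le _ _).trans
          (Finset.sum_le_sum fun F _ => ?_))
        exact ((measurePreserving_comp_perm_s19 (Measure.pi μ) (σ F)).measure_preimage_le _).trans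
          (hprob n hn n le_rfl μ hμ hμ0)
      _ = ENNReal.ofReal ((distPatterns s).card * (n : ℝ) ^ (-(γ + 8))) := by
        rw [ENNReal.ofReal_mul (by positivity), ENNReal.ofReal_natCast]
        simp
      _ ≤ ENNReal.ofReal ((n : ℝ) ^ (-γ)) := by
        refine ENNReal.ofReal_le_ofReal ?_
        have h1 : ((distPatterns s).card : ℝ) ≤ (n : ℝ) ^ 8 := by
          exact_mod_cast card_distPatterns_le s hn
        have h2 : (n : ℝ) ^ (-γ) = (n : ℝ) ^ 8 * (n : ℝ) ^ (-(γ + 8)) := by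
          rw [← Real.rpow_natCast, ← Real.rpow_add hn0]
          congr 1
          push_cast
          ring
        rw [h2]
        gcongr
  have huniv : (1 : ENNReal) ≤ P G + P Gᶜ := by
    rw [← measure_univ (μ := P), ← Set.union_compl_self G]
    exact measure_union_le _ _
  rw [ENNReal.ofReal_sub _ (by positivity), ENNReal.ofReal_one]
  exact tsub_le_iff_right.2 (huniv.trans (add_le_add_right hbad _))
end
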